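/- Let A(t), B(t) ∈ ℤ[t] be such that Δ(t) = −16(4A(t)³ + 27B(t)²) is not the zero polynomial and the j-invariant j(t) = −6912·A(t)³/(4A(t)³ + 27B(t)²) is a non-constant rational function. Let a be a nonzero integer. Then there is a constant C (depending only on A, B and a) such that for all real positive x and T, Σ_{τ ∈ F(T), Δ(τ) ≠ 0} Π_{E(τ)}(a, x) ≤ C·(T²·x^{3/4} + T·x^{3/2+o(1)}); more precisely, for every ε > 0 there is a constant C > 0 (depending only on A, B, a, ε) with Σ_{τ ∈ F(T), Δ(τ) ≠ 0} Π_{E(τ)}(a, x) ≤ C·(T²·x^{3/4} + T·x^{3/2+ε}). -/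

import Mathlib

/-- The Farey pairs of order `T`: coprime pairs `(α, β)` of positive integers
with `α, β ≤ T`; the pair `(α, β)` represents the Farey fraction `α/β ∈ F(T)`. -/
noncomputable def fareyPairs (T : ℝ) : Finset (ℕ × ℕ) :=
  (Finset.Icc 1 ⌊T⌋₊ ×ˢ Finset.Icc 1 ⌊T⌋₊).filter fun ab => Nat.Coprime ab.1 ab.2

/-- The Farey fraction `α/β ∈ ℚ` associated to a pair `(α, β)`. -/
def fareyFrac (ab : ℕ × ℕ) : ℚ := (ab.1 : ℚ) / (ab.2 : ℚ)

/-- Evaluation of an integer polynomial at a rational point. -/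
def evalQ (A : Polynomial ℤ) (τ : ℚ) : ℚ := Polynomial.eval₂ (Int.castRingHom ℚ) τ A

/-- The discriminant `Δ(τ) = −16(4A(τ)³ + 27B(τ)²)` of the specialized curve
`E(τ) : Y² = X³ + A(τ)X + B(τ)`. -/
def discQ (A B : Polynomial ℤ) (τ : ℚ) : ℚ :=
  -16 * (4 * evalQ A τ ^ 3 + 27 * evalQ B τ ^ 2)

/-- The reduction of a rational number modulo `p` (for `p` not dividing the
denominator this is the usual reduction). -/
def ratRed (p : ℕ) (q : ℚ) : ZMod p := (q.num : ZMod p) * ((q.den : ZMod p))⁻¹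

/-- The curve `E(τ) : Y² = X³ + A(τ)X + B(τ)` has good reduction at `p` (for this
model): `p` divides neither the denominators of `A(τ)`, `B(τ)` nor the
discriminant `Δ(τ)`, i.e. `p ∤ N(τ)`. -/
def goodRed (A B : Polynomial ℤ) (τ : ℚ) (p : ℕ) : Prop :=
  ¬ (p : ℤ) ∣ (evalQ A τ).den ∧ ¬ (p : ℤ) ∣ (evalQ B τ).den ∧
    ratRed p (discQ A B τ) ≠ 0

/-- The number of affine points `(x, y) ∈ 𝔽_p²` on `y² = x³ + a·x + b`. -/
def affinePoints (p : ℕ) (a b : ZMod p) : ℕ :=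
  ((Finset.range p ×ˢ Finset.range p).filter fun xy =>
    (xy.2 : ZMod p) ^ 2 = (xy.1 : ZMod p) ^ 3 + a * (xy.1 : ZMod p) + b).card

/-- The Frobenius trace `a_p(τ) = p + 1 − #E_p(τ)(𝔽_p)` of the reduction mod `p`
of the curve `E(τ) : Y² = X³ + A(τ)X + B(τ)` (the projective point count is the
affine count plus one, for the point at infinity). -/
def apFrob (A B : Polynomial ℤ) (τ : ℚ) (p : ℕ) : ℤ :=
  (p : ℤ) - affinePoints p (ratRed p (evalQ A τ)) (ratRed p (evalQ B τ))

open Classical in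
/-- `Π_{E(τ)}(a, x)`: the number of primes `p ≤ x` of good reduction for `E(τ)`
with `a_p(τ) = a`. -/
noncomputable def PiTrace (A B : Polynomial ℤ) (τ : ℚ) (a : ℤ) (x : ℝ) : ℕ :=
  ((Finset.range (⌊x⌋₊ + 1)).filter fun p =>
    p.Prime ∧ goodRed A B τ p ∧ apFrob A B τ p = a).card

/-- The `j`-invariant `j(t) = −6912·A(t)³/(4A(t)³ + 27B(t)²)` is a non-constant
rational function: for no constant `c ∈ ℚ` does `−6912·A(t)³ = c·(4A(t)³ + 27B(t)²)`
hold identically. -/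
def jNonconstant (A B : Polynomial ℤ) : Prop :=
  ∀ c : ℚ, (-6912 : Polynomial ℚ) * (A.map (Int.castRingHom ℚ)) ^ 3 ≠
    Polynomial.C c *
      (4 * (A.map (Int.castRingHom ℚ)) ^ 3 + 27 * (B.map (Int.castRingHom ℚ)) ^ 2)

section

open Polynomial

section DerivationPower

variable {k A : Type*} [CommRing k] [CommRing A] [Algebra k A]

theorem Derivation.iterate_mul (D : Derivation k A A) (n : ℕ) (a b : A) :
    D^[n] (a * b) = ∑ i ∈ Finset.range (n + 1), (n.choose i) • (D^[n - i] a * D^[i] b) := by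
  have key : ∀ n : ℕ, D^[n] (a * b) =
      ∑ ij ∈ Finset.HasAntidiagonal.antidiagonal n, (n.choose ij.1) • (D^[ij.2] a * D^[ij.1] b) := by
    intro n
    induction n with
    | zero => simp
    | succ n ih =>
      rw [Function.iterate_succ_apply', ih, map_sum]
      rw [Finset.sum_antidiagonal_choose_succ_nsmul (fun i j => D^[j] a * D^[i] b) n,
        ← Finset.sum_add_distrib]
      refine Finset.sum_congr rfl fun ij hij => ?_
      simp only [map_nsmul, Derivation.leibniz, smul_eq_mul, Function.iterate_succ_apply']
      rw [Nat.choose_symm_of_eq_add (Finset.HasAntidiagonal.mem_antidiagonal.1 hij).symm,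
        ← smul_add]
      congr 1
      ring
  rw [key, Finset.Nat.sum_antidiagonal_eq_sum_range_succ
    (fun i j => (n.choose i) • (D^[j] a * D^[i] b))]

theorem Derivation.iterate_prime_mul {p : ℕ} [Fact p.Prime] [CharP A p]
    (D : Derivation k A A) (a b : A) :
    D^[p] (a * b) = a * D^[p] b + b * D^[p] a := by
  have hp := (Fact.out : p.Prime)
  rw [D.iterate_mul, Finset.sum_range_succ, Finset.sum_range_eq_add_Ico _ hp.pos,
    Finset.sum_eq_zero]
  · simp; ring
  · intro i hi
    rw [Finset.mem_Ico] at hi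
    rw [← Nat.cast_smul_eq_nsmul A,
      (CharP.cast_eq_zero_iff A p _).2 (hp.dvd_choose_self (by omega) hi.2), zero_smul]

theorem Derivation.iterate_add (D : Derivation k A A) (n : ℕ) (a b : A) :
    D^[n] (a + b) = D^[n] a + D^[n] b := by
  induction n with
  | zero => rfl
  | succ n ih => rw [Function.iterate_succ_apply', ih, map_add]; simp [Function.iterate_succ_apply']

theorem Derivation.iterate_smul (D : Derivation k A A) (n : ℕ) (c : k) (a : A) :
    D^[n] (c • a) = c • D^[n] a := by
  induction n with
  | zero => rfl
  | succ n ih => rw [Function.iterate_succ_apply', ih, map_smul]; simp [Function.iterate_succ_apply']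

/-- In characteristic `p`, the operator `D ^ p - D` is again a derivation. -/
def Derivation.frobeniusDefect (p : ℕ) [Fact p.Prime] [CharP A p] (D : Derivation k A A) :
    Derivation k A A :=
  Derivation.mk'
    { toFun := fun a => D^[p] a - D a
      map_add' := fun a b => by rw [D.iterate_add, map_add]; ring
      map_smul' := fun c a => by rw [D.iterate_smul, map_smul, RingHom.id_apply, smul_sub] }
    (fun a b => by
      simp only [LinearMap.coe_mk, AddHom.coe_mk, D.iterate_prime_mul, Derivation.leibniz,
        smul_eq_mul]
      ring)

theorem Derivation.frobeniusDefect_apply (p : ℕ) [Fact p.Prime] [CharP A p]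
    (D : Derivation k A A) (a : A) : D.frobeniusDefect p a = D^[p] a - D a := rfl

end DerivationPower

section Theta

variable {K : Type*} [Field K]

/-- The derivation `(t - t²) d/dt` of `K[t]`. -/
noncomputable def logTheta (K : Type*) [Field K] : Derivation K K[X] K[X] :=
  (X - X ^ 2 : K[X]) • Polynomial.derivative'

theorem logTheta_apply (a : K[X]) : logTheta K a = (X - X ^ 2) * derivative a := by
  simp [logTheta, Polynomial.derivative']

theorem natDegree_logTheta_le (a : K[X]) : (logTheta K a).natDegree ≤ a.natDegree + 1 := by
  rw [logTheta_apply]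
  by_cases h : a.natDegree = 0
  · rw [derivative_of_natDegree_zero h]; simp
  · have h1 : (X - X ^ 2 : K[X]).natDegree ≤ 2 := by compute_degree
    have h2 := natDegree_derivative_le a
    have := natDegree_mul_le (p := (X - X ^ 2 : K[X])) (q := derivative a)
    omega

theorem logTheta_iterate_prime (p : ℕ) [Fact p.Prime] [CharP K p] (a : K[X]) :
    (logTheta K)^[p] a = logTheta K a := by
  have hp := (Fact.out : p.Prime)
  obtain ⟨m, rfl⟩ : ∃ m, p = m + 1 + 1 := ⟨p - 2, by have := hp.two_le; omega⟩
  have hm : (m : K[X]) = -2 := by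
    have := CharP.cast_eq_zero K[X] (m + 1 + 1)
    push_cast at this
    linear_combination this
  set N := (logTheta K).frobeniusDefect (m + 1 + 1) with hN
  set u : K[X] := X * (1 - X) ^ (m + 1) with hu
  have hu1 : logTheta K u = u := by
    rw [logTheta_apply, hu]
    simp only [derivative_mul, derivative_X, derivative_pow, derivative_sub, derivative_one]
    simp only [map_natCast, Nat.add_sub_cancel]
    push_cast
    rw [hm]
    ring
  have hu0 : u ≠ 0 := by
    refine mul_ne_zero X_ne_zero (pow_ne_zero _ ?_)
    intro h
    have := congrArg (eval 0) h
    simp at this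
  have hNu : N u = 0 := by
    rw [hN, Derivation.frobeniusDefect_apply, hu1, Function.iterate_fixed hu1, sub_self]
  have hder : ∀ b : K[X], N b = derivative b * N X := by
    intro b
    have : N = (N X) • (Polynomial.derivative' : Derivation K K[X] K[X]) := by
      apply Polynomial.derivation_ext
      simp [Polynomial.derivative']
    conv_lhs => rw [this]
    simp [Polynomial.derivative', mul_comm]
  have hNX : N X = 0 := by
    rw [hder u] at hNu
    rcases mul_eq_zero.1 hNu with h | h
    · rw [logTheta_apply, h, mul_zero] at hu1
      exact absurd hu1.symm hu0
    · exact h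
  have := hder a
  rw [hNX, mul_zero, hN, Derivation.frobeniusDefect_apply, sub_eq_zero] at this
  exact this

end Theta

section Legendre

variable {K : Type*} [Field K]

/-- The operator `X_i ∂/∂X_j` on polynomials in two variables over `R`. -/
noncomputable def polarization (R : Type*) [CommRing R] (i j : Fin 2) :
    Derivation R (MvPolynomial (Fin 2) R) (MvPolynomial (Fin 2) R) :=
  (MvPolynomial.X i : MvPolynomial (Fin 2) R) • MvPolynomial.pderiv j

theorem polarization_apply {R : Type*} [CommRing R] (i j : Fin 2) (Q : MvPolynomial (Fin 2) R) :
    polarization R i j Q = MvPolynomial.X i * MvPolynomial.pderiv j Q := rfl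

theorem coeff_polarization {R : Type*} [CommRing R] (i j : Fin 2) (s : Fin 2 →₀ ℕ) :
    ∃ (c : ℕ) (s' : Fin 2 →₀ ℕ), s'.degree = s.degree ∧
      ∀ Q : MvPolynomial (Fin 2) R, (polarization R i j Q).coeff s = c * Q.coeff s' := by
  by_cases h : i ∈ s.support
  · refine ⟨(s - Finsupp.single i 1 : Fin 2 →₀ ℕ) j + 1, s - Finsupp.single i 1 + Finsupp.single j 1, ?_, ?_⟩
    · have hs : s - Finsupp.single i 1 + Finsupp.single i 1 = s := by
        apply tsub_add_cancel_of_le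
        rw [Finsupp.single_le_iff]
        exact Nat.one_le_iff_ne_zero.2 (Finsupp.mem_support_iff.1 h)
      conv_rhs => rw [← hs]
      simp [map_add]
    · intro Q
      rw [polarization_apply, MvPolynomial.coeff_X_mul', if_pos h, MvPolynomial.coeff_pderiv]
      push_cast
      ring
  · refine ⟨0, s, rfl, fun Q => ?_⟩
    rw [polarization_apply, MvPolynomial.coeff_X_mul', if_neg h]
    simp

/-- A derivation of `A` acting on the coefficients of polynomials. -/
noncomputable def coeffDerivation {k A : Type*} [CommRing k] [CommRing A] [Algebra k A]
    (D : Derivation k A A) :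
    Derivation k (MvPolynomial (Fin 2) A) (MvPolynomial (Fin 2) A) :=
  have hc : ∀ (Q : MvPolynomial (Fin 2) A) s, (∑ m ∈ Q.support, MvPolynomial.monomial m (D (Q.coeff m))).coeff s =
      D (Q.coeff s) := fun Q s => by
    rw [MvPolynomial.coeff_sum]
    simp only [MvPolynomial.coeff_monomial]
    rw [Finset.sum_ite_eq']
    split_ifs with h
    · rfl
    · rw [MvPolynomial.notMem_support_iff.1 h, map_zero]
  Derivation.mk'
    { toFun := fun Q => ∑ m ∈ Q.support, MvPolynomial.monomial m (D (Q.coeff m))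
      map_add' := fun P Q => by
        ext s
        rw [MvPolynomial.coeff_add, hc, hc, hc, MvPolynomial.coeff_add, map_add]
      map_smul' := fun c Q => by
        ext s
        rw [RingHom.id_apply, MvPolynomial.coeff_smul, hc, hc, MvPolynomial.coeff_smul,
          Derivation.map_smul] }
    (fun P Q => by
      ext s
      simp only [LinearMap.coe_mk, AddHom.coe_mk, smul_eq_mul, MvPolynomial.coeff_add]
      rw [hc, mul_comm Q]
      simp only [MvPolynomial.coeff_mul, hc, map_sum, ← Finset.sum_add_distrib]
      refine Finset.sum_congr rfl fun x _ => ?_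
      rw [Derivation.leibniz, smul_eq_mul, smul_eq_mul]
      ring)

theorem coeff_coeffDerivation {k A : Type*} [CommRing k] [CommRing A] [Algebra k A]
    (D : Derivation k A A) (Q : MvPolynomial (Fin 2) A) (s : Fin 2 →₀ ℕ) :
    (coeffDerivation D Q).coeff s = D (Q.coeff s) := by
  change (∑ m ∈ Q.support, MvPolynomial.monomial m (D (Q.coeff m))).coeff s = _
  rw [MvPolynomial.coeff_sum]
  simp only [MvPolynomial.coeff_monomial]
  rw [Finset.sum_ite_eq']
  split_ifs with h
  · rfl
  · rw [MvPolynomial.notMem_support_iff.1 h, map_zero]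

/-- `(t - t²) / 4`. -/
noncomputable def legendreTau (K : Type*) [Field K] : K[X] := C (4⁻¹ : K) * (X - X ^ 2)

/-- The derivation of `K[t][X, Y]` that extends `(t - t²) d/dt` and has
`X ↦ Y`, `Y ↦ (t - t²) X / 4`. -/
noncomputable def legendreD (K : Type*) [Field K] :
    Derivation K (MvPolynomial (Fin 2) K[X]) (MvPolynomial (Fin 2) K[X]) :=
  coeffDerivation (logTheta K) + (polarization K[X] 1 0).restrictScalars K +
    (MvPolynomial.C (legendreTau K) : MvPolynomial (Fin 2) K[X]) •
      (polarization K[X] 0 1).restrictScalars K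

theorem legendreD_apply (Q : MvPolynomial (Fin 2) K[X]) :
    legendreD K Q = coeffDerivation (logTheta K) Q + polarization K[X] 1 0 Q +
      MvPolynomial.C (legendreTau K) * polarization K[X] 0 1 Q := rfl

theorem legendreD_C (a : K[X]) : legendreD K (MvPolynomial.C a) = MvPolynomial.C (logTheta K a) := by
  rw [legendreD_apply]
  simp only [polarization_apply, MvPolynomial.pderiv_C, mul_zero, add_zero]
  ext1 s
  rw [coeff_coeffDerivation, MvPolynomial.coeff_C, MvPolynomial.coeff_C]
  split_ifs <;> simp

theorem coeffDerivation_X (i : Fin 2) :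
    coeffDerivation (logTheta K) (MvPolynomial.X i) = 0 := by
  ext1 s
  rw [coeff_coeffDerivation, MvPolynomial.coeff_X]
  split_ifs <;> simp

theorem legendreD_X_zero :
    legendreD K (MvPolynomial.X 0) = MvPolynomial.X 1 := by
  rw [legendreD_apply, coeffDerivation_X, polarization_apply, polarization_apply]
  simp

theorem legendreD_X_one :
    legendreD K (MvPolynomial.X 1) = MvPolynomial.C (legendreTau K) * MvPolynomial.X 0 := by
  rw [legendreD_apply, coeffDerivation_X, polarization_apply, polarization_apply]
  simp

/-- Polynomials in `K[t][X, Y]` supported on monomials whose degree satisfies `S`,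
with coefficients of degree at most `I` in `t`. -/
def SizeBound (S : ℕ → Prop) (I : ℕ) (Q : MvPolynomial (Fin 2) K[X]) : Prop :=
  ∀ s, (Q.coeff s ≠ 0 → S s.degree) ∧ (Q.coeff s).natDegree ≤ I

namespace SizeBound

variable {S : ℕ → Prop} {I : ℕ} {Q : MvPolynomial (Fin 2) K[X]}

theorem mono (h : SizeBound S I Q) {I' : ℕ} (hI : I ≤ I') : SizeBound S I' Q :=
  fun s => ⟨(h s).1, (h s).2.trans hI⟩

theorem add {Q' : MvPolynomial (Fin 2) K[X]} (h : SizeBound S I Q) (h' : SizeBound S I Q') :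
    SizeBound S I (Q + Q') := by
  intro s
  rw [MvPolynomial.coeff_add]
  refine ⟨fun hs => ?_, natDegree_add_le_of_degree_le (h s).2 (h' s).2⟩
  by_cases h1 : Q.coeff s = 0
  · rw [h1, zero_add] at hs
    exact (h' s).1 hs
  · exact (h s).1 h1

theorem zero : SizeBound S I (0 : MvPolynomial (Fin 2) K[X]) := fun s => by simp

theorem sum {ι : Type*} (A : Finset ι) (f : ι → MvPolynomial (Fin 2) K[X])
    (h : ∀ i ∈ A, SizeBound S I (f i)) : SizeBound S I (∑ i ∈ A, f i) :=
  Finset.sum_induction f (SizeBound S I) (fun _ _ => SizeBound.add) SizeBound.zero h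

theorem C_mul (h : SizeBound S I Q) (a : K[X]) :
    SizeBound S (a.natDegree + I) (MvPolynomial.C a * Q) := by
  intro s
  rw [MvPolynomial.coeff_C_mul]
  exact ⟨fun hs => (h s).1 (right_ne_zero_of_mul hs),
    natDegree_mul_le.trans (Nat.add_le_add_left (h s).2 _)⟩

theorem polarization (h : SizeBound S I Q) (i j : Fin 2) :
    SizeBound S I (polarization K[X] i j Q) := by
  intro s
  obtain ⟨c, s', hs', hc⟩ := coeff_polarization (R := K[X]) i j s
  rw [hc, ← hs']
  refine ⟨fun hs => (h s').1 (right_ne_zero_of_mul hs), natDegree_mul_le.trans ?_⟩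
  simpa using (h s').2

theorem legendreD (h : SizeBound S I Q) : SizeBound S (I + 2) (legendreD K Q) := by
  rw [legendreD_apply]
  refine SizeBound.add (SizeBound.add ?_ ((h.polarization 1 0).mono (by omega))) ?_
  · intro s
    rw [coeff_coeffDerivation]
    refine ⟨fun hs => (h s).1 ?_, ?_⟩
    · intro h0
      rw [h0, map_zero] at hs
      exact hs rfl
    · have := natDegree_logTheta_le (Q.coeff s)
      have := (h s).2
      omega
  · refine ((h.polarization 0 1).C_mul _).mono ?_
    have : (legendreTau K).natDegree ≤ 2 := by
      unfold legendreTau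
      compute_degree
    omega

theorem legendreD_iterate (h : SizeBound S I Q) (m : ℕ) :
    SizeBound S (I + 2 * m) ((_root_.legendreD K)^[m] Q) := by
  induction m with
  | zero => exact h
  | succ m ih =>
    rw [Function.iterate_succ_apply']
    exact ih.legendreD

end SizeBound

/-- Substitution of `h`, `G` for the two variables. -/
noncomputable def pairEval (h G : K[X]) : MvPolynomial (Fin 2) K[X] →ₐ[K[X]] K[X] :=
  MvPolynomial.aeval ![h, G]

theorem pairEval_legendreD {h G : K[X]} (hh : logTheta K h = G)
    (hG : logTheta K G = legendreTau K * h) (Q : MvPolynomial (Fin 2) K[X]) :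
    pairEval h G (legendreD K Q) = logTheta K (pairEval h G Q) := by
  induction Q using MvPolynomial.induction_on with
  | C a =>
    rw [legendreD_C]
    simp [pairEval]
  | add P Q hP hQ => simp only [map_add, hP, hQ]
  | mul_X Q i hQ =>
    have hX : pairEval h G (legendreD K (MvPolynomial.X i)) =
        logTheta K (pairEval h G (MvPolynomial.X i)) := by
      fin_cases i
      · simp [legendreD_X_zero, pairEval, hh]
      · simp [legendreD_X_one, pairEval, hG]
    simp only [Derivation.leibniz, map_mul, map_add, smul_eq_mul, hX, hQ]

theorem pairEval_legendreD_iterate {h G : K[X]} (hh : logTheta K h = G)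
    (hG : logTheta K G = legendreTau K * h) (m : ℕ) (Q : MvPolynomial (Fin 2) K[X]) :
    pairEval h G ((legendreD K)^[m] Q) = (logTheta K)^[m] (pairEval h G Q) := by
  induction m with
  | zero => rfl
  | succ m ih =>
    rw [Function.iterate_succ_apply', Function.iterate_succ_apply', pairEval_legendreD hh hG, ih]

end Legendre

section Curvature

variable {K : Type*} [Field K]

theorem legendreD_linear (a b : K[X]) :
    legendreD K (MvPolynomial.C a * MvPolynomial.X 0 + MvPolynomial.C b * MvPolynomial.X 1) =
      MvPolynomial.C (logTheta K a + legendreTau K * b) * MvPolynomial.X 0 +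
        MvPolynomial.C (logTheta K b + a) * MvPolynomial.X 1 := by
  simp only [map_add, Derivation.leibniz, legendreD_C, legendreD_X_zero, legendreD_X_one,
    smul_eq_mul, map_mul]
  ring

theorem legendreD_iterate_linear (a b : K[X]) (m : ℕ) : ∃ a' b' : K[X],
    (legendreD K)^[m] (MvPolynomial.C a * MvPolynomial.X 0 + MvPolynomial.C b * MvPolynomial.X 1) =
      MvPolynomial.C a' * MvPolynomial.X 0 + MvPolynomial.C b' * MvPolynomial.X 1 := by
  induction m with
  | zero => exact ⟨a, b, rfl⟩
  | succ m ih =>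
    obtain ⟨a', b', h⟩ := ih
    exact ⟨_, _, by rw [Function.iterate_succ_apply', h, legendreD_linear]⟩

theorem legendreD_iterate_X_zero (m : ℕ) : ∃ a b : K[X], a.eval 0 = 0 ∧ b.eval 0 = 0 ∧
    (legendreD K)^[m + 2] (MvPolynomial.X 0) =
      MvPolynomial.C a * MvPolynomial.X 0 + MvPolynomial.C b * MvPolynomial.X 1 := by
  induction m with
  | zero =>
    refine ⟨legendreTau K, 0, by simp [legendreTau], by simp, ?_⟩
    simp [legendreD_X_zero, legendreD_X_one]
  | succ m ih =>
    obtain ⟨a, b, ha, hb, h⟩ := ih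
    refine ⟨_, _, ?_, ?_, by
      rw [show m + 1 + 2 = (m + 2) + 1 by ring, Function.iterate_succ_apply', h, legendreD_linear]⟩
    · simp [logTheta_apply, legendreTau]
    · simp [logTheta_apply, ha]

theorem linear_form_ext {a b a' b' : K[X]}
    (h : (MvPolynomial.C a * MvPolynomial.X 0 + MvPolynomial.C b * MvPolynomial.X 1 :
      MvPolynomial (Fin 2) K[X]) =
      MvPolynomial.C a' * MvPolynomial.X 0 + MvPolynomial.C b' * MvPolynomial.X 1) :
    a = a' ∧ b = b' := by
  have h0 := congrArg (MvPolynomial.aeval (![1, 0] : Fin 2 → K[X])) h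
  have h1 := congrArg (MvPolynomial.aeval (![0, 1] : Fin 2 → K[X])) h
  simp at h0 h1
  exact ⟨h0, h1⟩

/-- The `p`-curvature of the system `Θ X = Y`, `Θ Y = (t - t²) X / 4` is nilpotent,
with kernel spanned by the solution `(h, G)`. -/
theorem legendre_pCurvature (p : ℕ) [Fact p.Prime] [CharP K p] {h G : K[X]}
    (hh : logTheta K h = G) (hG : logTheta K G = legendreTau K * h) :
    ∃ q : K[X], q ≠ 0 ∧ ∀ Q : MvPolynomial (Fin 2) K[X],
      MvPolynomial.C (h ^ 2) * ((legendreD K)^[p] Q - legendreD K Q) =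
        MvPolynomial.C q * (MvPolynomial.C (h ^ 2) * polarization K[X] 1 0 Q +
          MvPolynomial.C (h * G) * (polarization K[X] 1 1 Q - polarization K[X] 0 0 Q) -
          MvPolynomial.C (G ^ 2) * polarization K[X] 0 1 Q) := by
  have hp := (Fact.out : p.Prime)
  set N := (legendreD K).frobeniusDefect p with hN
  have hNC : ∀ a, N (MvPolynomial.C a) = 0 := by
    intro a
    have hit : ∀ m, (legendreD K)^[m] (MvPolynomial.C a) =
        MvPolynomial.C ((logTheta K)^[m] a) := by
      intro m
      induction m with
      | zero => rfl
      | succ m ih =>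
        rw [Function.iterate_succ_apply', Function.iterate_succ_apply', ih, legendreD_C]
    rw [hN, Derivation.frobeniusDefect_apply, hit, legendreD_C, logTheta_iterate_prime, sub_self]
  have hNCmul : ∀ a Q, N (MvPolynomial.C a * Q) = MvPolynomial.C a * N Q := by
    intro a Q
    rw [Derivation.leibniz, hNC, smul_zero, add_zero, smul_eq_mul]
  have hev : ∀ Q, pairEval h G (N Q) = 0 := by
    intro Q
    rw [hN, Derivation.frobeniusDefect_apply, map_sub, pairEval_legendreD_iterate hh hG,
      pairEval_legendreD hh hG, logTheta_iterate_prime, sub_self]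
  have hlin : ∀ a b : K[X], ∃ a' b' : K[X],
      N (MvPolynomial.C a * MvPolynomial.X 0 + MvPolynomial.C b * MvPolynomial.X 1) =
      MvPolynomial.C a' * MvPolynomial.X 0 + MvPolynomial.C b' * MvPolynomial.X 1 := by
    intro a b
    obtain ⟨a', b', h1⟩ := legendreD_iterate_linear a b p
    refine ⟨a' - (logTheta K a + legendreTau K * b), b' - (logTheta K b + a), ?_⟩
    rw [hN, Derivation.frobeniusDefect_apply, h1, legendreD_linear]
    simp only [map_sub]
    ring
  obtain ⟨u, q, huq, hq0⟩ : ∃ u q : K[X], N (MvPolynomial.X 0) =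
      MvPolynomial.C u * MvPolynomial.X 0 + MvPolynomial.C q * MvPolynomial.X 1 ∧ q ≠ 0 := by
    obtain ⟨m, rfl⟩ : ∃ m, p = m + 2 := ⟨p - 2, by have := hp.two_le; omega⟩
    obtain ⟨a, b, -, hb, hab⟩ := legendreD_iterate_X_zero (K := K) m
    refine ⟨a, b - 1, ?_, ?_⟩
    · rw [hN, Derivation.frobeniusDefect_apply, hab, legendreD_X_zero, map_sub, map_one]
      ring
    · intro h1
      rw [sub_eq_zero.1 h1, eval_one] at hb
      exact one_ne_zero hb
  obtain ⟨u', q', huq'⟩ := hlin 0 1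
  simp only [map_zero, zero_mul, zero_add, map_one, one_mul] at huq'
  have e1 : u * h + q * G = 0 := by
    have := hev (MvPolynomial.X 0)
    rw [huq] at this
    simpa [pairEval] using this
  -- the form `h Y - G X` is horizontal
  have hZ : N (MvPolynomial.C (-G) * MvPolynomial.X 0 + MvPolynomial.C h * MvPolynomial.X 1) = 0 := by
    have hD : legendreD K (MvPolynomial.C (-G) * MvPolynomial.X 0 +
        MvPolynomial.C h * MvPolynomial.X 1) = 0 := by
      rw [legendreD_linear, map_neg, hh, hG]
      simp
    rw [hN, Derivation.frobeniusDefect_apply, hD]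
    obtain ⟨m, hm⟩ : ∃ m, p = m + 1 := ⟨p - 1, by have := hp.pos; omega⟩
    rw [hm, Function.iterate_succ_apply, hD, sub_zero]
    exact Function.iterate_fixed (map_zero _) _
  have e2 : -(G * u) + h * u' = 0 ∧ -(G * q) + h * q' = 0 := by
    apply linear_form_ext (K := K)
    rw [map_add, hNCmul, hNCmul, huq, huq'] at hZ
    simp only [map_zero, zero_mul, add_zero]
    rw [← hZ]
    simp only [map_neg, map_mul, map_add]
    ring
  refine ⟨q, hq0, ?_⟩
  intro Q
  rw [← Derivation.frobeniusDefect_apply, ← hN]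
  induction Q using MvPolynomial.induction_on with
  | C a => simp [hNC]
  | add P Q hP hQ =>
    simp only [map_add, mul_add, hP, hQ]
    ring
  | mul_X Q i hQ =>
    have hX : MvPolynomial.C (h ^ 2) * N (MvPolynomial.X i) =
      MvPolynomial.C q * (MvPolynomial.C (h ^ 2) * polarization K[X] 1 0 (MvPolynomial.X i) +
        MvPolynomial.C (h * G) * (polarization K[X] 1 1 (MvPolynomial.X i) -
          polarization K[X] 0 0 (MvPolynomial.X i)) -
        MvPolynomial.C (G ^ 2) * polarization K[X] 0 1 (MvPolynomial.X i)) := by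
      fin_cases i
      · have : u * h = - (q * G) := by linear_combination e1
        have h3 := congrArg (MvPolynomial.C (σ := Fin 2)) this
        simp only [map_mul, map_neg] at h3
        simp [huq, polarization_apply]
        linear_combination (MvPolynomial.C h * MvPolynomial.X 0) * h3
      · have h3 := congrArg (MvPolynomial.C (σ := Fin 2)) e1
        have h4 := congrArg (MvPolynomial.C (σ := Fin 2)) e2.1
        have h5 := congrArg (MvPolynomial.C (σ := Fin 2)) e2.2
        simp only [map_mul, map_neg, map_add, map_zero] at h3 h4 h5
        simp [huq', polarization_apply]
        linear_combination (MvPolynomial.C h * MvPolynomial.X 0) * h4 +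
          (MvPolynomial.C h * MvPolynomial.X 1) * h5 + (MvPolynomial.C G * MvPolynomial.X 0) * h3
    simp only [Derivation.leibniz, smul_eq_mul]
    linear_combination Q * hX + MvPolynomial.X i * hQ

end Curvature

section Bordered

variable {A σ : Type*} [CommRing A]

theorem natDegree_det_le_of_forall {K : Type*} [Field K] {r B : ℕ}
    (M : Matrix (Fin r) (Fin r) K[X]) (h : ∀ i j, (M i j).natDegree ≤ B) :
    M.det.natDegree ≤ r * B := by
  rw [Matrix.det_apply]
  refine natDegree_sum_le_of_forall_le _ _ fun g _ => ?_
  refine (natDegree_smul_le _ _).trans ((natDegree_prod_le _ _).trans ?_)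
  refine (Finset.sum_le_card_nsmul _ _ B fun i _ => h _ _).trans ?_
  simp

theorem snoc_matrix_eq_updateRow {r : ℕ} (w : Fin r → σ → A) (s : Fin r → σ) (v : σ → A)
    (s' : σ) :
    (Matrix.of fun i j : Fin (r + 1) =>
      (Fin.snoc (α := fun _ => σ → A) w v i) (Fin.snoc (α := fun _ => σ) s s' j)) =
    (Matrix.of fun i j : Fin (r + 1) => (Fin.snoc (α := fun _ => σ → A) w 0 i)
      (Fin.snoc (α := fun _ => σ) s s' j)).updateRow (Fin.last r)
      (fun j => v (Fin.snoc (α := fun _ => σ) s s' j)) := by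
  ext i j
  refine Fin.lastCases ?_ (fun i => ?_) i
  · simp
  · simp

/-- The minor of the vectors `w 0, …, w (r - 1)` on the coordinates `s`,
bordered by a further vector `v` and a further coordinate. -/
noncomputable def borderedMinor {r : ℕ} (w : Fin r → σ → A) (s : Fin r → σ) :
    (σ → A) →ₗ[A] (σ → A) where
  toFun v s' := (Matrix.of fun i j : Fin (r + 1) =>
    (Fin.snoc (α := fun _ => σ → A) w v i) (Fin.snoc (α := fun _ => σ) s s' j)).det
  map_add' v v' := by
    funext s'
    rw [Pi.add_apply, snoc_matrix_eq_updateRow, snoc_matrix_eq_updateRow w s v,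
      snoc_matrix_eq_updateRow w s v', ← Matrix.det_updateRow_add]
    rfl
  map_smul' c v := by
    funext s'
    rw [Pi.smul_apply, snoc_matrix_eq_updateRow, snoc_matrix_eq_updateRow w s v, smul_eq_mul, RingHom.id_apply, ← Matrix.det_updateRow_smul]
    rfl

variable {r : ℕ} (w : Fin r → σ → A) (s : Fin r → σ)

theorem borderedMinor_apply (v : σ → A) (s' : σ) : borderedMinor w s v s' =
    (Matrix.of fun i j : Fin (r + 1) =>
      (Fin.snoc (α := fun _ => σ → A) w v i) (Fin.snoc (α := fun _ => σ) s s' j)).det := rfl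

theorem borderedMinor_self (i : Fin r) : borderedMinor w s (w i) = 0 := by
  funext s'
  rw [borderedMinor_apply]
  exact Matrix.det_zero_of_row_eq (Fin.castSucc_lt_last i).ne (by funext j; simp)

theorem borderedMinor_expand (v : σ → A) : ∃ c : Fin r → A, ∀ s', borderedMinor w s v s' =
    (Matrix.of fun i j : Fin r => w i (s j)).det * v s' + ∑ i, c i * w i s' := by
  refine ⟨fun i => (-1) ^ ((i.castSucc : ℕ) + (Fin.last r : ℕ)) *
    (Matrix.of fun i' j : Fin r => (Fin.snoc (α := fun _ => σ → A) w v (i.castSucc.succAbove i'))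
      (s j)).det, fun s' => ?_⟩
  rw [borderedMinor_apply, Matrix.det_succ_column _ (Fin.last r), Fin.sum_univ_castSucc, add_comm]
  congr 1
  · simp only [Fin.val_last, Matrix.of_apply, Fin.snoc_last, Fin.succAbove_last]
    rw [Even.neg_one_pow ⟨r, rfl⟩, one_mul, mul_comm]
    congr 2
    ext i j
    simp
  · refine Finset.sum_congr rfl fun i _ => ?_
    simp only [Matrix.of_apply, Fin.snoc_last, Fin.snoc_castSucc, Fin.succAbove_last]
    rw [mul_right_comm]
    congr 3
    ext i' j
    simp

theorem natDegree_borderedMinor_le {K : Type*} [Field K] (w : Fin r → σ → K[X]) {v : σ → K[X]}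
    {B : ℕ} (hw : ∀ i m, (w i m).natDegree ≤ B) (hv : ∀ m, (v m).natDegree ≤ B) (s' : σ) :
    (borderedMinor w s v s').natDegree ≤ (r + 1) * B := by
  refine natDegree_det_le_of_forall _ fun i j => ?_
  refine Fin.lastCases ?_ (fun i => ?_) i
  · simpa using hv _
  · simpa using hw _ _

end Bordered

section ZeroEstimate

variable {K : Type*} [Field K]

theorem coeff_polarization_self {R : Type*} [CommRing R] (i : Fin 2)
    (Q : MvPolynomial (Fin 2) R) (s : Fin 2 →₀ ℕ) :
    (polarization R i i Q).coeff s = s i * Q.coeff s := by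
  rw [polarization_apply, MvPolynomial.coeff_X_mul']
  split_ifs with h
  · have hi : 1 ≤ s i := Nat.one_le_iff_ne_zero.2 (Finsupp.mem_support_iff.1 h)
    have hs : s - Finsupp.single i 1 + Finsupp.single i 1 = s :=
      tsub_add_cancel_of_le (Finsupp.single_le_iff.2 hi)
    rw [MvPolynomial.coeff_pderiv, hs, mul_comm]
    congr 1
    have : (s - Finsupp.single i 1 : Fin 2 →₀ ℕ) i = s i - 1 := by simp
    rw [this]
    exact_mod_cast congrArg (Nat.cast (R := R)) (by omega : s i - 1 + 1 = s i)
  · rw [Finsupp.notMem_support_iff.1 h]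
    simp

theorem X_pow_prime_dvd_logTheta (p : ℕ) [CharP K p] {a : K[X]} (h : X ^ p ∣ a) :
    X ^ p ∣ logTheta K a := by
  obtain ⟨b, rfl⟩ := h
  rw [logTheta_apply, derivative_mul, derivative_X_pow]
  simp only [CharP.cast_eq_zero, map_zero, zero_mul, zero_add]
  exact Dvd.intro _ (by ring : X ^ p * ((X - X ^ 2) * derivative b) = _)

theorem X_pow_prime_dvd_logTheta_iterate (p : ℕ) [CharP K p] {a : K[X]} (h : X ^ p ∣ a) (m : ℕ) :
    X ^ p ∣ (logTheta K)^[m] a := by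
  induction m with
  | zero => exact h
  | succ m ih =>
    rw [Function.iterate_succ_apply']
    exact X_pow_prime_dvd_logTheta p ih

theorem eq_zero_of_quadratic_relation {h G a b c : K[X]} (hcop : IsCoprime h G)
    (ha : a.natDegree < h.natDegree) (hb : b.natDegree < h.natDegree)
    (hc : c.natDegree < h.natDegree) (H : h ^ 2 * a + h * G * b - G ^ 2 * c = 0) :
    a = 0 ∧ b = 0 ∧ c = 0 := by
  have h0 : h ≠ 0 := by
    rintro rfl
    simp at ha
  have hc0 : c = 0 := by
    refine eq_zero_of_dvd_of_natDegree_lt ?_ hc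
    refine (hcop.pow_right (n := 2)).dvd_of_dvd_mul_left ⟨h * a + G * b, ?_⟩
    linear_combination -H
  have hb0 : b = 0 := by
    refine eq_zero_of_dvd_of_natDegree_lt ?_ hb
    refine hcop.dvd_of_dvd_mul_left ⟨-a, ?_⟩
    apply mul_left_cancel₀ h0
    rw [hc0] at H
    linear_combination H
  refine ⟨?_, hb0, hc0⟩
  rw [hc0, hb0] at H
  simpa [h0] using H

/-- The coefficients of a polynomial in two variables, as a function on exponents. -/
noncomputable def coeffFun (R : Type*) [CommRing R] :
    MvPolynomial (Fin 2) R →ₗ[R] ((Fin 2 →₀ ℕ) → R) :=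
  LinearMap.pi fun s => MvPolynomial.lcoeff R s

theorem coeffFun_apply {R : Type*} [CommRing R] (Q : MvPolynomial (Fin 2) R) (s : Fin 2 →₀ ℕ) :
    coeffFun R Q s = Q.coeff s := rfl

theorem card_le_of_minor_ne_zero {d r : ℕ} {w : Fin r → MvPolynomial (Fin 2) K[X]} {I : ℕ}
    (hw : ∀ i, SizeBound (· ≤ d) I (w i)) (s : Fin r → (Fin 2 →₀ ℕ))
    (hs : (Matrix.of fun i j : Fin r => coeffFun K[X] (w i) (s j)).det ≠ 0) :
    r ≤ (d + 1) ^ 2 := by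
  have hinj : Function.Injective s := by
    intro j j' hjj
    by_contra hne
    exact hs (Matrix.det_zero_of_column_eq hne fun i => by simp [hjj])
  have hdeg : ∀ j, (s j).degree ≤ d := by
    intro j
    by_contra hlt
    refine hs (Matrix.det_eq_zero_of_column_eq_zero j fun i => ?_)
    by_contra h0
    exact hlt ((hw i (s j)).1 h0)
  have hdeg' : ∀ j k, s j k < d + 1 := fun j k =>
    Nat.lt_succ_of_le ((Finsupp.le_degree k (s j)).trans (hdeg j))
  let f : Fin r → Fin (d + 1) × Fin (d + 1) := fun j => (⟨s j 0, hdeg' j 0⟩, ⟨s j 1, hdeg' j 1⟩)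
  have hf : Function.Injective f := by
    intro j j' hjj
    apply hinj
    ext k
    have h1 := congrArg (fun x => (x.1 : ℕ)) hjj
    have h2 := congrArg (fun x => (x.2 : ℕ)) hjj
    fin_cases k
    · exact h1
    · exact h2
  have := Fintype.card_le_of_injective f hf
  simpa [sq] using this

theorem exists_maximal_minor {d : ℕ} (w : ℕ → MvPolynomial (Fin 2) K[X])
    (hw : ∀ i, ∃ I, SizeBound (· ≤ d) I (w i)) :
    ∃ (r : ℕ) (s : Fin r → (Fin 2 →₀ ℕ)), r ≤ (d + 1) ^ 2 ∧
      (Matrix.of fun i j : Fin r => coeffFun K[X] (w i) (s j)).det ≠ 0 ∧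
      borderedMinor (fun i : Fin r => coeffFun K[X] (w i)) s (coeffFun K[X] (w r)) = 0 := by
  have hcard : ∀ (r : ℕ) (s : Fin r → (Fin 2 →₀ ℕ)),
      (Matrix.of fun i j : Fin r => coeffFun K[X] (w i) (s j)).det ≠ 0 → r ≤ (d + 1) ^ 2 := by
    intro r s hs
    choose I hI using hw
    refine card_le_of_minor_ne_zero (w := fun i : Fin r => w i)
      (I := ∑ i ∈ Finset.range r, I i) (fun i => (hI i).mono ?_) s hs
    exact Finset.single_le_sum (f := I) (fun _ _ => Nat.zero_le _) (Finset.mem_range.2 i.2)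
  by_contra hcon
  push Not at hcon
  have hall : ∀ r : ℕ, ∃ s : Fin r → (Fin 2 →₀ ℕ),
      (Matrix.of fun i j : Fin r => coeffFun K[X] (w i) (s j)).det ≠ 0 := by
    intro r
    induction r with
    | zero => exact ⟨Fin.elim0, by simp⟩
    | succ r ih =>
      obtain ⟨s, hs⟩ := ih
      have h1 := hcon r s (hcard r s hs) hs
      obtain ⟨s', hs'⟩ := Function.ne_iff.1 h1
      refine ⟨Fin.snoc s s', ?_⟩
      rw [borderedMinor_apply, Pi.zero_apply] at hs'
      convert hs' using 2
      ext1 i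
      refine Fin.lastCases ?_ (fun i => ?_) i
      · simp
      · simp
  obtain ⟨s, hs⟩ := hall ((d + 1) ^ 2 + 1)
  have := hcard _ s hs
  omega

end ZeroEstimate

section HighestWeight

variable {K : Type*} [Field K]

theorem exists_polarization_eq_zero {d I : ℕ} (W : Submodule K[X] (MvPolynomial (Fin 2) K[X]))
    (hW : ∀ Q ∈ W, polarization K[X] 0 1 Q ∈ W) {P : MvPolynomial (Fin 2) K[X]} (hP : P ∈ W)
    (hP0 : P ≠ 0) (hPs : SizeBound (· ≤ d) I P) :
    ∃ Q ∈ W, Q ≠ 0 ∧ SizeBound (· ≤ d) I Q ∧ polarization K[X] 0 1 Q = 0 := by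
  have key : ∀ k : ℕ, ∀ P ∈ W, P ≠ 0 → SizeBound (· ≤ d) I P →
      (∀ s, P.coeff s ≠ 0 → s 1 < k) →
      ∃ Q ∈ W, Q ≠ 0 ∧ SizeBound (· ≤ d) I Q ∧ polarization K[X] 0 1 Q = 0 := by
    intro k
    induction k with
    | zero =>
      intro P _ hP0 _ hk
      obtain ⟨s, hs⟩ := MvPolynomial.ne_zero_iff.1 hP0
      exact absurd (hk s hs) (Nat.not_lt_zero _)
    | succ k ih =>
      intro P hP hP0 hPs hk
      by_cases h0 : polarization K[X] 0 1 P = 0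
      · exact ⟨P, hP, hP0, hPs, h0⟩
      refine ih _ (hW P hP) h0 (hPs.polarization 0 1) fun s hs => ?_
      rw [polarization_apply, MvPolynomial.coeff_X_mul'] at hs
      split_ifs at hs with h
      · rw [MvPolynomial.coeff_pderiv] at hs
        have := hk _ (left_ne_zero_of_mul hs)
        simp at this
        exact this
      · exact absurd rfl hs
  refine key (d + 1) P hP hP0 hPs fun s hs => Nat.lt_succ_of_le ?_
  exact (Finsupp.le_degree 1 s).trans ((hPs s).1 hs)

theorem natCast_poly_ne_zero (p : ℕ) [CharP K p] {m : ℕ} (h0 : m ≠ 0) (hm : m < p) :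
    (m : K[X]) ≠ 0 := by
  rw [Ne, CharP.cast_eq_zero_iff K[X] p]
  exact fun h => absurd (Nat.le_of_dvd (Nat.pos_of_ne_zero h0) h) (not_le.2 hm)

theorem exists_monomial_mem (p : ℕ) [CharP K p] {d I : ℕ} (hd : d < p)
    (W : Submodule K[X] (MvPolynomial (Fin 2) K[X]))
    (hW : ∀ Q ∈ W, polarization K[X] 0 1 Q ∈ W)
    (hW' : ∀ Q ∈ W, polarization K[X] 1 1 Q - polarization K[X] 0 0 Q ∈ W)
    {P : MvPolynomial (Fin 2) K[X]} (hP : P ∈ W)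
    (hP0 : P ≠ 0) (hPs : SizeBound (· ≤ d) I P) :
    ∃ (c : K[X]) (k : ℕ), c ≠ 0 ∧ c.natDegree ≤ I ∧
      MvPolynomial.C c * MvPolynomial.X 0 ^ k ∈ W := by
  classical
  have hY : ∀ Q : MvPolynomial (Fin 2) K[X], SizeBound (· ≤ d) I Q →
      polarization K[X] 0 1 Q = 0 → ∀ s, Q.coeff s ≠ 0 → s 1 = 0 := by
    intro Q hQ h s hs
    by_contra h1
    rw [polarization_apply] at h
    have h2 := (mul_eq_zero.1 h).resolve_left (MvPolynomial.X_ne_zero 0)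
    have h3 := congrArg (MvPolynomial.coeff (s - Finsupp.single 1 1)) h2
    have hs1 : s - Finsupp.single 1 1 + Finsupp.single 1 1 = s :=
      tsub_add_cancel_of_le (Finsupp.single_le_iff.2 (Nat.one_le_iff_ne_zero.2 h1))
    rw [MvPolynomial.coeff_pderiv, hs1, MvPolynomial.coeff_zero] at h3
    refine (mul_ne_zero hs ?_) h3
    have h4 : (s - Finsupp.single 1 1 : Fin 2 →₀ ℕ) 1 + 1 = s 1 := by
      simp
      omega
    have := natCast_poly_ne_zero (K := K) p h1
      (((Finsupp.le_degree 1 s).trans ((hQ s).1 hs)).trans_lt hd)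
    rw [← h4] at this
    exact_mod_cast this
  have key : ∀ n : ℕ, ∀ Q ∈ W, Q ≠ 0 → SizeBound (· ≤ d) I Q → Q.support.card ≤ n →
      (∀ s, Q.coeff s ≠ 0 → s 1 = 0) →
      ∃ (c : K[X]) (k : ℕ), c ≠ 0 ∧ c.natDegree ≤ I ∧
        MvPolynomial.C c * MvPolynomial.X 0 ^ k ∈ W := by
    intro n
    induction n with
    | zero =>
      intro Q _ hQ0 _ hn _
      rw [Nat.le_zero, Finset.card_eq_zero, MvPolynomial.support_eq_empty] at hn
      exact absurd hn hQ0
    | succ n ih =>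
      intro Q hQ hQ0 hQs hn hQY
      obtain ⟨s, hs⟩ := MvPolynomial.ne_zero_iff.1 hQ0
      by_cases hone : ∀ s', Q.coeff s' ≠ 0 → s' = s
      · refine ⟨Q.coeff s, s 0, hs, (hQs s).2, ?_⟩
        convert hQ using 1
        ext1 m
        rw [MvPolynomial.coeff_C_mul, MvPolynomial.coeff_X_pow]
        have hs0 : Finsupp.single 0 (s 0) = s := by
          ext k
          fin_cases k
          · simp
          · simp [hQY s hs]
        rw [hs0]
        split_ifs with h
        · rw [h, mul_one]
        · rw [mul_zero]
          by_contra hm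
          exact h (hone m (Ne.symm hm)).symm
      · push Not at hone
        obtain ⟨s', hs', hss⟩ := hone
        set Q' := (polarization K[X] 1 1 Q - polarization K[X] 0 0 Q) + (s 0 : K[X]) • Q with hQ'
        have hco : ∀ m, Q'.coeff m = ((m 1 : K[X]) - m 0 + s 0) * Q.coeff m := by
          intro m
          rw [hQ', MvPolynomial.coeff_add, MvPolynomial.coeff_sub, coeff_polarization_self,
            coeff_polarization_self, MvPolynomial.coeff_smul, smul_eq_mul]
          ring
        have hsub : ∀ m, Q'.coeff m ≠ 0 → Q.coeff m ≠ 0 := fun m hm => by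
          rw [hco] at hm
          exact right_ne_zero_of_mul hm
        have hlt : ∀ m, Q.coeff m ≠ 0 → m 0 < p := fun m hm =>
          ((Finsupp.le_degree 0 m).trans ((hQs m).1 hm)).trans_lt hd
        refine ih Q' (W.add_mem (hW' Q hQ) (W.smul_mem _ hQ)) ?_ ?_ ?_ ?_
        · refine MvPolynomial.ne_zero_iff.2 ⟨s', ?_⟩
          rw [hco, hQY s' hs']
          refine mul_ne_zero ?_ hs'
          have hne : s 0 ≠ s' 0 := by
            intro h
            apply hss
            ext k
            fin_cases k
            · exact h.symm
            · simp [hQY s hs, hQY s' hs']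
          have h1 := hlt s hs
          have h2 := hlt s' hs'
          rcases lt_or_gt_of_ne hne with h | h
          · have := natCast_poly_ne_zero (K := K) p (m := s' 0 - s 0) (by omega) (by omega)
            rw [Nat.cast_sub h.le] at this
            intro h0
            apply this
            rw [Nat.cast_zero] at h0
            linear_combination -h0
          · have := natCast_poly_ne_zero (K := K) p (m := s 0 - s' 0) (by omega) (by omega)
            rw [Nat.cast_sub h.le] at this
            intro h0
            apply this
            rw [Nat.cast_zero] at h0
            linear_combination h0
        · intro m
          refine ⟨fun hm => (hQs m).1 (hsub m hm), ?_⟩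
          rw [hco]
          refine natDegree_mul_le.trans ?_
          have : ((m 1 : K[X]) - m 0 + s 0).natDegree = 0 := by
            have := natDegree_intCast (R := K) ((m 1 : ℤ) - m 0 + s 0)
            push_cast at this
            exact this
          rw [this, zero_add]
          exact (hQs m).2
        · have : Q'.support ⊂ Q.support := by
            refine Finset.ssubset_iff_subset_ne.2 ⟨fun m hm => ?_, fun h => ?_⟩
            · exact MvPolynomial.mem_support_iff.2 (hsub m (MvPolynomial.mem_support_iff.1 hm))
            · have := MvPolynomial.mem_support_iff.1 (h ▸ MvPolynomial.mem_support_iff.2 hs)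
              rw [hco, hQY s hs] at this
              simp at this
          have := Finset.card_lt_card this
          omega
        · exact fun m hm => hQY m (hsub m hm)
  obtain ⟨Q, hQ, hQ0, hQs, hQf⟩ := exists_polarization_eq_zero W hW hP hP0 hPs
  exact key _ Q hQ hQ0 hQs le_rfl (hY Q hQs hQf)

end HighestWeight

section ZeroEstimate

variable {K : Type*} [Field K]

/-- The `K[X]`-saturation of the span of `w 0, …, w (r - 1)`, cut out by bordered minors. -/
noncomputable def minorSpan (w : ℕ → MvPolynomial (Fin 2) K[X]) {r : ℕ}
    (s : Fin r → (Fin 2 →₀ ℕ)) : Submodule K[X] (MvPolynomial (Fin 2) K[X]) :=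
  LinearMap.ker ((borderedMinor (fun i : Fin r => coeffFun K[X] (w i)) s).comp (coeffFun K[X]))

variable {w : ℕ → MvPolynomial (Fin 2) K[X]} {r : ℕ} {s : Fin r → (Fin 2 →₀ ℕ)}

theorem mem_minorSpan {Q : MvPolynomial (Fin 2) K[X]} : Q ∈ minorSpan w s ↔
    borderedMinor (fun i : Fin r => coeffFun K[X] (w i)) s (coeffFun K[X] Q) = 0 := Iff.rfl

theorem mem_minorSpan_of_smul_mem {Q : MvPolynomial (Fin 2) K[X]} {a : K[X]} (ha : a ≠ 0)
    (h : a • Q ∈ minorSpan w s) : Q ∈ minorSpan w s := by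
  rw [mem_minorSpan, map_smul, map_smul] at h
  exact (smul_eq_zero.1 h).resolve_left ha

theorem exists_smul_eq_of_mem_minorSpan {Q : MvPolynomial (Fin 2) K[X]}
    (h : Q ∈ minorSpan w s) : ∃ c : Fin r → K[X],
      (Matrix.of fun i j : Fin r => coeffFun K[X] (w i) (s j)).det • Q = ∑ i, c i • w i := by
  obtain ⟨c, hc⟩ := borderedMinor_expand (fun i : Fin r => coeffFun K[X] (w i)) s (coeffFun K[X] Q)
  refine ⟨fun i => -c i, ?_⟩
  ext1 m
  have := hc m
  rw [mem_minorSpan.1 h, Pi.zero_apply] at this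
  rw [MvPolynomial.coeff_smul, MvPolynomial.coeff_sum]
  simp only [MvPolynomial.coeff_smul, smul_eq_mul, coeffFun_apply, neg_mul,
    Finset.sum_neg_distrib] at this ⊢
  linear_combination -this

theorem map_mem_minorSpan
    (hΔ : (Matrix.of fun i j : Fin r => coeffFun K[X] (w i) (s j)).det ≠ 0)
    (L : MvPolynomial (Fin 2) K[X] →ₗ[K[X]] MvPolynomial (Fin 2) K[X])
    (hL : ∀ i : Fin r, L (w i) ∈ minorSpan w s) {Q : MvPolynomial (Fin 2) K[X]}
    (hQ : Q ∈ minorSpan w s) : L Q ∈ minorSpan w s := by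
  obtain ⟨c, hc⟩ := exists_smul_eq_of_mem_minorSpan hQ
  refine mem_minorSpan_of_smul_mem hΔ ?_
  rw [← map_smul, hc, map_sum]
  exact Submodule.sum_mem _ fun i _ => by
    rw [map_smul]
    exact Submodule.smul_mem _ _ (hL i)

theorem legendreD_smul (a : K[X]) (Q : MvPolynomial (Fin 2) K[X]) :
    legendreD K (a • Q) = a • legendreD K Q + logTheta K a • Q := by
  rw [MvPolynomial.smul_eq_C_mul, Derivation.leibniz, legendreD_C, smul_eq_mul, smul_eq_mul,
    MvPolynomial.smul_eq_C_mul, MvPolynomial.smul_eq_C_mul, mul_comm Q]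

theorem legendreD_mem_minorSpan
    (hΔ : (Matrix.of fun i j : Fin r => coeffFun K[X] (w i) (s j)).det ≠ 0)
    (hw : ∀ i, legendreD K (w i) = w (i + 1)) (hmem : ∀ i ≤ r, w i ∈ minorSpan w s)
    {Q : MvPolynomial (Fin 2) K[X]}
    (hQ : Q ∈ minorSpan w s) : legendreD K Q ∈ minorSpan w s := by
  obtain ⟨c, hc⟩ := exists_smul_eq_of_mem_minorSpan hQ
  refine mem_minorSpan_of_smul_mem hΔ ?_
  have h := congrArg (legendreD K) hc
  rw [legendreD_smul, map_sum] at h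
  rw [eq_sub_of_add_eq h]
  refine Submodule.sub_mem _ (Submodule.sum_mem _ fun i _ => ?_) (Submodule.smul_mem _ _ hQ)
  rw [legendreD_smul, hw]
  exact Submodule.add_mem _ (Submodule.smul_mem _ _ (hmem _ i.2))
    (Submodule.smul_mem _ _ (hmem _ i.2.le))

/-- A Shidlovskii-type zero estimate: a small nonzero polynomial in `h` and its derivative does
not vanish at the origin to the order of the characteristic. -/
theorem not_X_pow_dvd_pairEval (p : ℕ) [Fact p.Prime] [CharP K p] {h G : K[X]}
    (hh : logTheta K h = G) (hG : logTheta K G = legendreTau K * h) (h0 : h.eval 0 ≠ 0)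
    (hcop : IsCoprime h G) {d I : ℕ} {P : MvPolynomial (Fin 2) K[X]} (hP0 : P ≠ 0)
    (hPs : SizeBound (· ≤ d) I P) (hd : d < p)
    (hlt : ((d + 1) ^ 2 + 1) * (I + 2 * (d + 1) ^ 2) + I < h.natDegree)
    (hhp : h.natDegree < p) : ¬ X ^ p ∣ pairEval h G P := by
  intro hdvd
  set w : ℕ → MvPolynomial (Fin 2) K[X] := fun i => (legendreD K)^[i] P with hwdef
  have hws : ∀ i, SizeBound (· ≤ d) (I + 2 * i) (w i) := fun i => hPs.legendreD_iterate i
  have hw1 : ∀ i, legendreD K (w i) = w (i + 1) := fun i =>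
    (Function.iterate_succ_apply' _ _ _).symm
  obtain ⟨r, s, hr, hΔ, hmin⟩ := exists_maximal_minor w fun i => ⟨_, hws i⟩
  have hmem : ∀ i ≤ r, w i ∈ minorSpan w s := by
    intro i hi
    rcases hi.lt_or_eq with hi | rfl
    · exact mem_minorSpan.2 (borderedMinor_self (fun i : Fin r => coeffFun K[X] (w i)) s ⟨i, hi⟩)
    · exact mem_minorSpan.2 hmin
  have hstable : ∀ Q ∈ minorSpan w s, legendreD K Q ∈ minorSpan w s := fun Q hQ =>
    legendreD_mem_minorSpan hΔ hw1 hmem hQ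
  have hiter : ∀ m : ℕ, ∀ Q ∈ minorSpan w s, (legendreD K)^[m] Q ∈ minorSpan w s := by
    intro m
    induction m with
    | zero => exact fun Q hQ => hQ
    | succ m ih =>
      intro Q hQ
      rw [Function.iterate_succ_apply]
      exact ih _ (hstable Q hQ)
  have hne : h ≠ 0 := by
    rintro rfl
    simp at h0
  obtain ⟨q, hq0, hq⟩ := legendre_pCurvature p hh hG
  have hcurv : ∀ Q ∈ minorSpan w s, h ^ 2 • polarization K[X] 1 0 Q +
      (h * G) • (polarization K[X] 1 1 Q - polarization K[X] 0 0 Q) -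
      G ^ 2 • polarization K[X] 0 1 Q ∈ minorSpan w s := by
    intro Q hQ
    refine mem_minorSpan_of_smul_mem hq0 ?_
    have := hq Q
    simp only [← MvPolynomial.smul_eq_C_mul] at this
    rw [← this]
    exact Submodule.smul_mem _ _ (Submodule.sub_mem _ (hiter p Q hQ) (hstable Q hQ))
  set B := I + 2 * (d + 1) ^ 2 with hB
  have hrB : (r + 1) * B < h.natDegree := by
    refine lt_of_le_of_lt ?_ hlt
    exact (Nat.mul_le_mul_right _ (by omega)).trans (Nat.le_add_right _ _)
  have hbase : ∀ i : Fin r, polarization K[X] 0 1 (w i) ∈ minorSpan w s ∧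
      polarization K[X] 1 1 (w i) - polarization K[X] 0 0 (w i) ∈ minorSpan w s := by
    intro i
    have hwB : ∀ i : Fin r, SizeBound (· ≤ d) B (w i) := fun i => (hws i).mono (by
      have := i.2
      omega)
    have hdeg : ∀ Q : MvPolynomial (Fin 2) K[X], SizeBound (· ≤ d) B Q → ∀ s',
        (borderedMinor (fun i : Fin r => coeffFun K[X] (w i)) s (coeffFun K[X] Q) s').natDegree <
          h.natDegree := fun Q hQ s' =>
      (natDegree_borderedMinor_le s _ (fun i m => (hwB i m).2) (fun m => (hQ m).2) s').trans_lt hrB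
    have h1 := mem_minorSpan.1 (hcurv _ (hmem i i.2.le))
    have h2 : ∀ s', _ := fun s' => eq_zero_of_quadratic_relation hcop
      (hdeg _ ((hwB i).polarization 1 0) s')
      (hdeg (polarization K[X] 1 1 (w i) + -polarization K[X] 0 0 (w i))
        (((hwB i).polarization 1 1).add ?_) s')
      (hdeg _ ((hwB i).polarization 0 1) s') ?_
    · refine ⟨mem_minorSpan.2 (funext fun s' => (h2 s').2.2), ?_⟩
      rw [sub_eq_add_neg]
      exact mem_minorSpan.2 (funext fun s' => (h2 s').2.1)
    · intro m
      rw [MvPolynomial.coeff_neg, natDegree_neg, neg_ne_zero]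
      exact (hwB i).polarization 0 0 m
    · rw [← sub_eq_add_neg]
      have h3 := congrFun h1 s'
      simp only [map_add, map_sub, map_smul, Pi.add_apply, Pi.sub_apply, Pi.smul_apply,
        smul_eq_mul, Pi.zero_apply] at h3 ⊢
      linear_combination h3
  have hf : ∀ Q ∈ minorSpan w s, polarization K[X] 0 1 Q ∈ minorSpan w s := fun Q hQ =>
    map_mem_minorSpan hΔ (polarization K[X] 0 1).toLinearMap (fun i => (hbase i).1) hQ
  have hhh : ∀ Q ∈ minorSpan w s,
      polarization K[X] 1 1 Q - polarization K[X] 0 0 Q ∈ minorSpan w s := fun Q hQ =>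
    map_mem_minorSpan hΔ ((polarization K[X] 1 1).toLinearMap - (polarization K[X] 0 0).toLinearMap)
      (fun i => (hbase i).2) hQ
  obtain ⟨c, k, hc0, hcI, hck⟩ := exists_monomial_mem p hd (minorSpan w s) hf hhh
    (hmem 0 (Nat.zero_le _)) hP0 hPs
  obtain ⟨c', hc'⟩ := exists_smul_eq_of_mem_minorSpan hck
  set Δ := (Matrix.of fun i j : Fin r => coeffFun K[X] (w i) (s j)).det with hΔdef
  have hdvdw : ∀ i, X ^ p ∣ pairEval h G (w i) := fun i => by
    rw [hwdef, pairEval_legendreD_iterate hh hG]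
    exact X_pow_prime_dvd_logTheta_iterate p hdvd i
  have h1 : X ^ p ∣ h ^ k * (Δ * c) := by
    have h2 := congrArg (pairEval h G) hc'
    rw [map_smul, map_sum, map_mul, map_pow] at h2
    have h3 : pairEval h G (MvPolynomial.C c) = c := by
      simp [pairEval]
    have h4 : pairEval h G (MvPolynomial.X 0) = h := by simp [pairEval]
    rw [h3, h4, smul_eq_mul] at h2
    rw [show h ^ k * (Δ * c) = Δ * (c * h ^ k) by ring, h2]
    refine Finset.dvd_sum fun i _ => ?_
    rw [map_smul, smul_eq_mul]
    exact (hdvdw i).mul_left _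
  have hX : IsCoprime (X : K[X]) h := by
    refine (Polynomial.irreducible_X.coprime_iff_not_dvd).2 fun h5 => h0 ?_
    rw [X_dvd_iff, coeff_zero_eq_eval_zero] at h5
    exact h5
  have h6 : X ^ p ∣ Δ * c := (hX.pow (m := p) (n := k)).dvd_of_dvd_mul_left h1
  have h7 := natDegree_le_of_dvd h6 (mul_ne_zero hΔ hc0)
  rw [natDegree_X_pow, natDegree_mul hΔ hc0] at h7
  have h8 : Δ.natDegree ≤ r * B := natDegree_det_le_of_forall _ fun i j =>
    (((hws i) (s j)).2.trans (by have := i.2; omega))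
  have h9 : r * B ≤ ((d + 1) ^ 2 + 1) * B := Nat.mul_le_mul_right _ (by omega)
  omega

end ZeroEstimate

section HassePolynomial

variable {K : Type*} [Field K]

theorem X_sub_C_pow_dvd_of_derivative (p : ℕ) [CharP K p] {M : ℕ} (hM : M < p) {Ψ : K[X]} {t : K}
    (h0 : Ψ.eval t = 0) (h1 : (X - C t) ^ M ∣ derivative Ψ) : (X - C t) ^ (M + 1) ∣ Ψ := by
  rcases eq_or_ne Ψ 0 with rfl | hΨ
  · exact dvd_zero _
  obtain ⟨Q, hQ, hQt⟩ := exists_eq_pow_rootMultiplicity_mul_and_not_dvd Ψ hΨ t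
  set m := Ψ.rootMultiplicity t
  rcases lt_or_ge M m with hlt | hle
  · rw [hQ]
    exact (pow_dvd_pow _ hlt).mul_right _
  exfalso
  have hm0 : 0 < m := (rootMultiplicity_pos hΨ).2 h0
  obtain ⟨k, hk⟩ : ∃ k, m = k + 1 := ⟨m - 1, by omega⟩
  have h2 : (X - C t) ^ (k + 1) ∣ derivative Ψ := (pow_dvd_pow _ (by omega)).trans h1
  rw [hQ, hk, derivative_mul, derivative_X_sub_C_pow, add_tsub_cancel_right,
    dvd_add_left (Dvd.intro _ rfl)] at h2
  have h3 : (X - C t) ^ k * (X - C t) ∣ (X - C t) ^ k * (C ((k + 1 : ℕ) : K) * Q) := by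
    rw [← pow_succ]
    convert h2 using 1
    ring
  have h4 := (mul_dvd_mul_iff_left (pow_ne_zero k (X_sub_C_ne_zero t))).1 h3
  have h5 : ((k + 1 : ℕ) : K) ≠ 0 := by
    rw [Ne, CharP.cast_eq_zero_iff K p]
    exact fun h => absurd (Nat.le_of_dvd (Nat.succ_pos k) h) (by omega)
  have h6 : IsUnit (C ((k + 1 : ℕ) : K)) := isUnit_C.2 (isUnit_iff_ne_zero.2 h5)
  exact hQt ((h6.dvd_mul_left).1 h4)

theorem X_sub_C_pow_dvd_of_logTheta (p : ℕ) [CharP K p] {t : K} (ht0 : t ≠ 0) (ht1 : t ≠ 1) {M : ℕ}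
    (hM : M ≤ p) {Ψ : K[X]} (h : ∀ m < M, ((logTheta K)^[m] Ψ).eval t = 0) :
    (X - C t) ^ M ∣ Ψ := by
  induction M generalizing Ψ with
  | zero => simp
  | succ M ih =>
    have h1 := ih (by omega) (Ψ := logTheta K Ψ) fun m hm => by
      rw [← Function.iterate_succ_apply]
      exact h (m + 1) (by omega)
    refine X_sub_C_pow_dvd_of_derivative p hM (h 0 (Nat.succ_pos M)) ?_
    rw [logTheta_apply] at h1
    refine IsCoprime.dvd_of_dvd_mul_left (IsCoprime.pow_left ?_) h1
    refine ((irreducible_X_sub_C t).coprime_iff_not_dvd).2 fun h2 => ?_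
    rw [dvd_iff_isRoot, IsRoot] at h2
    simp only [eval_sub, eval_X, eval_pow] at h2
    have : t * (1 - t) = 0 := by linear_combination h2
    rcases mul_eq_zero.1 this with h3 | h3
    · exact ht0 h3
    · exact ht1 (sub_eq_zero.1 h3).symm

/-- The Hasse polynomial of the Legendre family. -/
noncomputable def hassePoly (K : Type*) [Field K] (n : ℕ) : K[X] :=
  ∑ i ∈ Finset.range (n + 1), C ((n.choose i : K) ^ 2) * X ^ i

theorem coeff_hassePoly (n i : ℕ) : (hassePoly K n).coeff i = (n.choose i : K) ^ 2 := by
  rw [hassePoly, finsetSum_coeff]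
  simp only [coeff_C_mul_X_pow]
  rw [Finset.sum_ite_eq]
  split_ifs with h
  · rfl
  · rw [Nat.choose_eq_zero_of_lt (by simpa using h)]
    simp

theorem natDegree_hassePoly (n : ℕ) : (hassePoly K n).natDegree = n := by
  refine natDegree_eq_of_le_of_coeff_ne_zero ?_ (by simp [coeff_hassePoly])
  refine natDegree_le_iff_coeff_eq_zero.2 fun i hi => ?_
  rw [coeff_hassePoly, Nat.choose_eq_zero_of_lt hi]
  simp

theorem eval_zero_hassePoly (n : ℕ) : (hassePoly K n).eval 0 = 1 := by
  rw [← coeff_zero_eq_eval_zero, coeff_hassePoly]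
  simp

theorem eval_one_hassePoly (n : ℕ) : (hassePoly K n).eval 1 = ((2 * n).choose n : K) := by
  rw [← Nat.sum_range_choose_sq, hassePoly, eval_finsetSum]
  simp

theorem coeff_X_mul_derivative (f : K[X]) (i : ℕ) :
    (X * derivative f).coeff i = i * f.coeff i := by
  cases i with
  | zero => simp
  | succ i =>
    rw [coeff_X_mul, coeff_derivative]
    push_cast
    ring

theorem derivative_logTheta_hassePoly (p : ℕ) [CharP K p] {n : ℕ} (hp : p = 2 * n + 1) 
    (h4 : (4 : K) ≠ 0) :
    derivative (logTheta K (hassePoly K n)) = C 4⁻¹ * hassePoly K n := by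
  have hn : (2 * n + 1 : K) = 0 := by
    have := CharP.cast_eq_zero K p
    rw [hp] at this
    exact_mod_cast this
  rw [logTheta_apply, show (X - X ^ 2) * derivative (hassePoly K n) =
    X * derivative (hassePoly K n) - X * (X * derivative (hassePoly K n)) by ring]
  ext i
  rw [coeff_derivative, coeff_sub, coeff_X_mul, coeff_X_mul, coeff_X_mul_derivative,
    coeff_derivative, coeff_C_mul, coeff_hassePoly, coeff_hassePoly]
  have h1 : (n.choose (i + 1) : K) * (i + 1) = n.choose i * (n - i) := by
    have := Nat.choose_succ_right_eq n i
    rcases le_or_gt i n with hi | hi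
    · have := congrArg (Nat.cast (R := K)) this
      push_cast [hi] at this
      exact this
    · rw [Nat.choose_eq_zero_of_lt hi, Nat.choose_eq_zero_of_lt (by omega : n < i + 1)]
      simp
  have h5 : (4 : K)⁻¹ * 4 = 1 := inv_mul_cancel₀ h4
  have h6 : (n.choose (i + 1) : K) ^ 2 * (i + 1) ^ 2 = (n.choose i) ^ 2 * (n - i) ^ 2 := by
    rw [← mul_pow, h1, mul_pow]
  refine mul_left_cancel₀ h4 ?_
  linear_combination 4 * h6 - (n.choose i : K) ^ 2 * h5 +
    (n.choose i : K) ^ 2 * (2 * n - 4 * i - 1) * hn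

theorem logTheta_logTheta_hassePoly (p : ℕ) [CharP K p] {n : ℕ} (hp : p = 2 * n + 1)
    (h4 : (4 : K) ≠ 0) :
    logTheta K (logTheta K (hassePoly K n)) = legendreTau K * hassePoly K n := by
  rw [logTheta_apply, derivative_logTheta_hassePoly p hp h4, legendreTau]
  ring

theorem isCoprime_hassePoly [IsAlgClosed K] (p : ℕ) [Fact p.Prime] [CharP K p] {n : ℕ}
    (hp : p = 2 * n + 1) (h4 : (4 : K) ≠ 0) :
    IsCoprime (hassePoly K n) (logTheta K (hassePoly K n)) := by
  set h := hassePoly K n with hh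
  have hiter : ∀ m : ℕ, ∃ a b : K[X], (logTheta K)^[m] h = a * h + b * logTheta K h := by
    intro m
    induction m with
    | zero => exact ⟨1, 0, by simp⟩
    | succ m ih =>
      obtain ⟨a, b, hab⟩ := ih
      refine ⟨logTheta K a + b * legendreTau K, a + logTheta K b, ?_⟩
      rw [Function.iterate_succ_apply', hab, map_add, Derivation.leibniz, Derivation.leibniz,
        logTheta_logTheta_hassePoly p hp h4]
      simp only [smul_eq_mul]
      ring
  have hpp : p.Prime := Fact.out
  refine (isCoprime_iff_aeval_ne_zero_of_isAlgClosed (k := K) (K := K) _ _).2 fun t => ?_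
  by_contra hcon
  push Not at hcon
  simp only [coe_aeval_eq_eval] at hcon
  obtain ⟨e1, e2⟩ := hcon
  have ht0 : t ≠ 0 := by
    rintro rfl
    rw [hh, eval_zero_hassePoly] at e1
    exact one_ne_zero e1
  have ht1 : t ≠ 1 := by
    rintro rfl
    rw [hh, eval_one_hassePoly, CharP.cast_eq_zero_iff K p] at e1
    have h1 := Nat.choose_mul_factorial_mul_factorial (by omega : n ≤ 2 * n)
    have h2 : p ∣ (2 * n).factorial := by
      rw [← h1, mul_assoc]
      exact e1.mul_right _
    have h3 := hpp.dvd_factorial.1 h2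
    omega
  have h1 : (X - C t) ^ p ∣ h := X_sub_C_pow_dvd_of_logTheta p ht0 ht1 le_rfl fun m _ => by
    obtain ⟨a, b, hab⟩ := hiter m
    rw [hab, eval_add, eval_mul, eval_mul, e1, e2]
    ring
  have hne : h ≠ 0 := by
    intro h0
    have := eval_zero_hassePoly (K := K) n
    rw [← hh, h0] at this
    simp at this
  have h2 := natDegree_le_of_dvd h1 hne
  rw [natDegree_pow, natDegree_X_sub_C, hh, natDegree_hassePoly] at h2
  omega

end HassePolynomial

section Stepanov

variable {K : Type*} [Field K]

theorem SizeBound.X_pow_mul {N I : ℕ} {Q : MvPolynomial (Fin 2) K[X]}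
    (h : SizeBound (· = N) I Q) (e : ℕ) :
    SizeBound (· = N + e) I (MvPolynomial.X 0 ^ e * Q) := by
  induction e with
  | zero => simpa using h
  | succ e ih =>
    intro s
    rw [pow_succ', mul_assoc, MvPolynomial.coeff_X_mul']
    split_ifs with hs
    · refine ⟨fun h0 => ?_, (ih _).2⟩
      have h1 := (ih _).1 h0
      have h2 : (s - Finsupp.single 0 1) + Finsupp.single 0 1 = s :=
        tsub_add_cancel_of_le (Finsupp.single_le_iff.2
          (Nat.one_le_iff_ne_zero.2 (Finsupp.mem_support_iff.1 hs)))
      rw [← h2, map_add, Finsupp.degree_single, h1]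
      rfl
    · exact ⟨fun h0 => absurd rfl h0, by simp⟩

theorem SizeBound.weaken {S S' : ℕ → Prop} {I : ℕ} {Q : MvPolynomial (Fin 2) K[X]}
    (h : SizeBound S I Q) (hS : ∀ n, S n → S' n) : SizeBound S' I Q :=
  fun s => ⟨fun hs => hS _ ((h s).1 hs), (h s).2⟩

theorem SizeBound.smul {S : ℕ → Prop} {I : ℕ} {Q : MvPolynomial (Fin 2) K[X]}
    (h : SizeBound S I Q) (c : K) : SizeBound S I (c • Q) := by
  intro s
  rw [MvPolynomial.coeff_smul]
  refine ⟨fun hs => (h s).1 fun h0 => hs (by rw [h0, smul_zero]), ?_⟩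
  exact (natDegree_smul_le _ _).trans (h s).2

theorem sizeBound_monomial (s : Fin 2 →₀ ℕ) (a : K[X]) :
    SizeBound (· = s.degree) a.natDegree (MvPolynomial.monomial s a) := by
  intro s'
  rw [MvPolynomial.coeff_monomial]
  split_ifs with h
  · exact ⟨fun _ => by rw [h], le_rfl⟩
  · exact ⟨fun h0 => absurd rfl h0, by simp⟩

/-- Siegel's lemma for families of homogeneous polynomials of bounded size. -/
theorem exists_smul_sum_eq_zero {ι μ : Type*} [Fintype ι] [Fintype μ] {N T : ℕ}
    (F : ι → μ → MvPolynomial (Fin 2) K[X]) (hF : ∀ i m, SizeBound (· = N) T (F i m))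
    (hcard : Fintype.card μ * ((N + 1) * (T + 1)) < Fintype.card ι) :
    ∃ c : ι → K, c ≠ 0 ∧ ∀ m, ∑ i, c i • F i m = 0 := by
  let e : Fin (N + 1) → (Fin 2 →₀ ℕ) := fun k => Finsupp.single 0 (N - k) + Finsupp.single 1 (k : ℕ)
  let L : (ι → K) →ₗ[K] (μ × Fin (N + 1) × Fin (T + 1) → K) := 
    { toFun := fun c x => ((∑ i, c i • F i x.1).coeff (e x.2.1)).coeff x.2.2
      map_add' := fun c c' => by
        funext x
        simp [add_smul, Finset.sum_add_distrib]
      map_smul' := fun a c => by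
        funext x
        simp [mul_smul, ← Finset.smul_sum] }
  have hker : LinearMap.ker L ≠ ⊥ := by
    refine LinearMap.ker_ne_bot_of_finrank_lt ?_
    simpa [Module.finrank_fintype_fun_eq_card] using hcard
  obtain ⟨c, hc, hc0⟩ := (Submodule.ne_bot_iff _).1 hker
  refine ⟨c, hc0, fun m => ?_⟩
  have hs : SizeBound (· = N) T (∑ i, c i • F i m) :=
    SizeBound.sum _ _ fun i _ => (hF i m).smul _
  ext1 s
  by_contra h0
  have hdeg := (hs s).1 h0
  apply h0
  have hsum : s 0 + s 1 = N := by
    rw [← hdeg, Finsupp.degree_eq_sum, Fin.sum_univ_two]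
  have hse : e ⟨s 1, by omega⟩ = s := by
    ext k
    fin_cases k
    · simp [e]; omega
    · simp [e]
  rw [MvPolynomial.coeff_zero]
  ext t
  rw [coeff_zero]
  rcases lt_or_ge T t with ht | ht
  · exact coeff_eq_zero_of_natDegree_lt ((hs s).2.trans_lt ht)
  · have := congrFun (LinearMap.mem_ker.1 hc) (m, ⟨s 1, by omega⟩, ⟨t, by omega⟩)
    simp only [L, LinearMap.coe_mk, AddHom.coe_mk, Pi.zero_apply, hse] at this
    exact this

theorem logTheta_iterate_X_pow_mul (p : ℕ) [CharP K p] (j m : ℕ) (f : K[X]) :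
    (logTheta K)^[m] (X ^ (p * j) * f) = X ^ (p * j) * (logTheta K)^[m] f := by
  induction m with
  | zero => rfl
  | succ m ih =>
    rw [Function.iterate_succ_apply', Function.iterate_succ_apply', ih, logTheta_apply,
      logTheta_apply, derivative_mul, derivative_X_pow]
    push_cast
    rw [CharP.cast_eq_zero]
    simp
    ring

theorem card_mul_le_natDegree {Λ : Finset K} {M : ℕ} {Ψ : K[X]} (h0 : Ψ ≠ 0)
    (h : ∀ t ∈ Λ, (X - C t) ^ M ∣ Ψ) : Λ.card * M ≤ Ψ.natDegree := by
  have h1 : ∏ t ∈ Λ, (X - C t) ^ M ∣ Ψ := by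
    refine Finset.prod_dvd_of_coprime (fun t _ t' _ hne => ?_) h
    exact (pairwise_coprime_X_sub_C Function.injective_id hne).pow
  have h2 := natDegree_le_of_dvd h1 h0
  rw [natDegree_prod _ _ fun t _ => pow_ne_zero _ (X_sub_C_ne_zero t)] at h2
  simpa using h2

end Stepanov

section Stepanov

variable {K : Type*} [Field K]

/-- The exponent of `X₀ ^ (2 * (D + d) - l) * X₁ ^ l`. -/
noncomputable def pairExp (D d l : ℕ) : Fin 2 →₀ ℕ :=
  Finsupp.single 0 (2 * (D + d) - l) + Finsupp.single 1 l

theorem degree_pairExp {D d l : ℕ} (hl : l < 2 * D) : (pairExp D d l).degree = 2 * (D + d) := by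
  rw [pairExp, map_add, Finsupp.degree_single, Finsupp.degree_single]
  omega

theorem pairExp_injective {D d l d' l' : ℕ} (hl : l < 2 * D)
    (h : pairExp D d l = pairExp D d' l') : d = d' ∧ l = l' := by
  have h0 := DFunLike.congr_fun h 0
  have h1 := DFunLike.congr_fun h 1
  simp [pairExp] at h0 h1
  omega

/-- The monomials `tⁱ X₀ ^ (2 * (D + d) - l) X₁ ^ l`, indexed by `(i, d, l)`. -/
noncomputable def auxMonomial (K : Type*) [Field K] (D : ℕ) {I : ℕ}
    (x : Fin (I + 1) × Fin D × Fin (2 * D)) : MvPolynomial (Fin 2) K[X] :=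
  MvPolynomial.monomial (pairExp D x.2.1 x.2.2) (X ^ (x.1 : ℕ))

theorem sizeBound_auxMonomial {D I : ℕ} (x : Fin (I + 1) × Fin D × Fin (2 * D)) :
    SizeBound (· = 2 * (D + x.2.1)) I (auxMonomial K D x) := by
  have := (sizeBound_monomial (K := K) (pairExp D x.2.1 x.2.2) (X ^ (x.1 : ℕ))).mono
    (I' := I) (by rw [natDegree_X_pow]; omega)
  rwa [degree_pairExp x.2.2.2] at this

theorem sum_auxMonomial_ne_zero {D I : ℕ} {c : Fin (I + 1) × Fin D × Fin (2 * D) → K}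
    (hc : c ≠ 0) : ∑ x, c x • auxMonomial K D x ≠ 0 := by
  obtain ⟨x, hx⟩ := Function.ne_iff.1 hc
  intro h0
  apply hx
  have h1 := congrArg (fun Q => (MvPolynomial.coeff (pairExp D x.2.1 x.2.2) Q).coeff x.1) h0
  simp only [MvPolynomial.coeff_sum, MvPolynomial.coeff_smul, auxMonomial,
    MvPolynomial.coeff_monomial, finsetSum_coeff, coeff_smul] at h1
  rw [Finset.sum_eq_single x] at h1
  · simpa using h1
  · intro y _ hyx
    split_ifs with h
    · obtain ⟨h2, h3⟩ := pairExp_injective y.2.2.2 h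
      rw [coeff_X_pow, if_neg, smul_zero]
      intro h4
      exact hyx (Prod.ext (Fin.ext h4.symm) (Prod.ext (Fin.ext h2) (Fin.ext h3)))
    · simp
  · simp

theorem natDegree_pairEval_auxMonomial {D I n : ℕ} {h G : K[X]} (hn : h.natDegree ≤ n)
    (hGn : G.natDegree ≤ n + 1) (x : Fin (I + 1) × Fin D × Fin (2 * D)) :
    (pairEval h G (auxMonomial K D x)).natDegree ≤ I + 4 * D * (n + 1) := by
  have h1 : pairEval h G (auxMonomial K D x) =
      X ^ (x.1 : ℕ) * (h ^ (2 * (D + x.2.1) - x.2.2 : ℕ) * G ^ (x.2.2 : ℕ)) := by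
    rw [auxMonomial, pairEval, MvPolynomial.aeval_monomial]
    rw [Finsupp.prod_fintype _ _ (by simp), Fin.prod_univ_two]
    simp [pairExp]
  rw [h1]
  have h2 := x.2.1.2
  have h3 := x.2.2.2
  have h4 := x.1.2
  refine natDegree_mul_le.trans (Nat.add_le_add (by rw [natDegree_X_pow]; omega) ?_)
  refine natDegree_mul_le.trans ?_
  refine (Nat.add_le_add (natDegree_pow_le_of_le _ (hn.trans (Nat.le_succ n)))
    (natDegree_pow_le_of_le _ hGn)).trans ?_
  rw [← add_mul]
  exact Nat.mul_le_mul_right _ (by omega)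

theorem sum_X_pow_mul_ne_zero {p J : ℕ} {f : Fin J → K[X]}
    (hf : ∀ j, f j = 0 ∨ ¬ X ^ p ∣ f j) {j₀ : Fin J} (h0 : f j₀ ≠ 0) :
    ∑ j : Fin J, X ^ (p * (j : ℕ)) * f j ≠ 0 := by
  classical
  intro hsum
  obtain ⟨j, hj, hmin⟩ := Finset.exists_minimal (s := Finset.univ.filter fun j => f j ≠ 0)
    ⟨j₀, by simpa using h0⟩
  have hj0 : f j ≠ 0 := by simpa using hj
  refine ((hf j).resolve_left hj0) ?_
  rw [← Finset.add_sum_erase _ _ (Finset.mem_univ j)] at hsum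
  have h1 : X ^ (p * (j : ℕ)) * X ^ p ∣ X ^ (p * (j : ℕ)) * f j := by
    rw [eq_neg_of_add_eq_zero_left hsum, dvd_neg]
    refine Finset.dvd_sum fun i hi => ?_
    by_cases hfi : f i = 0
    · rw [hfi, mul_zero]
      exact dvd_zero _
    have hne := (Finset.mem_erase.1 hi).1
    have hlt : j < i := by
      rcases lt_or_gt_of_ne hne with h | h
      · exact absurd (hmin (by simpa using hfi) h.le) (not_le.2 h)
      · exact h
    rw [← pow_add]
    refine (pow_dvd_pow _ ?_).mul_right _
    rw [← Nat.mul_succ]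
    exact Nat.mul_le_mul_left _ hlt
  exact (mul_dvd_mul_iff_left (pow_ne_zero _ X_ne_zero)).1 h1

end Stepanov

section Stepanov

variable {K : Type*} [Field K]

theorem logTheta_iterate_sum_smul {ι : Type*} [Fintype ι] (c : ι → K) (f : ι → K[X]) (m : ℕ) :
    (logTheta K)^[m] (∑ y, c y • f y) = ∑ y, c y • (logTheta K)^[m] (f y) := by
  induction m with
  | zero => rfl
  | succ m ih =>
    rw [Function.iterate_succ_apply', ih, map_sum]
    exact Finset.sum_congr rfl fun y _ => by
      rw [Derivation.map_smul, Function.iterate_succ_apply']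

theorem stepanov_eval_aux {J D j d p : ℕ} (hj : j < J) (hd : d < D) {a e t η κ E : K}
    (h1 : e * t ^ p = a) (h2 : e * η ^ 2 = κ) :
    a ^ j * e ^ (J - j) * (κ ^ (D + d) * e ^ (D - d)) * (η ^ (2 * (D - d)) * E) =
      κ ^ (2 * D) * e ^ J * (t ^ (p * j) * E) := by
  have e1 : e ^ J = e ^ j * e ^ (J - j) := by rw [← pow_add]; congr 1; omega
  have e2 : κ ^ (2 * D) = κ ^ (D + d) * κ ^ (D - d) := by rw [← pow_add]; congr 1; omega
  have e3 : κ ^ (D - d) = e ^ (D - d) * η ^ (2 * (D - d)) := by rw [← h2, mul_pow, ← pow_mul]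
  rw [e1, e2, e3, ← h1, mul_pow, ← pow_mul]
  ring

theorem card_mul_le_of_legendre (p : ℕ) [Fact p.Prime] [CharP K p] {h G : K[X]}
    (hh : logTheta K h = G) (hG : logTheta K G = legendreTau K * h) (h0 : h.eval 0 ≠ 0)
    (hcop : IsCoprime h G) {n : ℕ} (hn : h.natDegree = n) (hpn : p = 2 * n + 1) {Λ : Finset K}
    {α δ : K[X]} (hα : α.natDegree ≤ 1) (hδ : δ.natDegree ≤ 1) {κ : K} (hκ : κ ≠ 0)
    (hΛ : ∀ t ∈ Λ, t ≠ 0 ∧ t ≠ 1 ∧ δ.eval t ≠ 0 ∧ δ.eval t * t ^ p = α.eval t ∧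
      δ.eval t * h.eval t ^ 2 = κ)
    {v : ℕ} (hv : 1 ≤ v) (hvp : 400000 * v ^ 4 ≤ p) : Λ.card * v ≤ 11 * p := by
  obtain ⟨J, hJ⟩ : ∃ J, J = 4 * v := ⟨_, rfl⟩
  obtain ⟨D, hD⟩ : ∃ D, D = 4 * v := ⟨_, rfl⟩
  obtain ⟨I, hI⟩ : ∃ I, I = 16 * v ^ 2 := ⟨_, rfl⟩
  obtain ⟨M, hM⟩ : ∃ M, M = 2 * v ^ 2 := ⟨_, rfl⟩
  have hv2 : v ≤ v ^ 2 := by nlinarith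
  have hv4 : v ^ 2 ≤ v ^ 4 := Nat.pow_le_pow_right hv (by norm_num)
  let F : Fin J × (Fin (I + 1) × Fin D × Fin (2 * D)) → Fin M → MvPolynomial (Fin 2) K[X] :=
    fun y m => MvPolynomial.C (α ^ (y.1 : ℕ) * δ ^ (J - y.1) *
      (C κ ^ (D + y.2.2.1) * δ ^ (D - y.2.2.1))) *
      (MvPolynomial.X 0 ^ (2 * (D - y.2.2.1)) * (legendreD K)^[m] (auxMonomial K D y.2))
  have hF : ∀ y m, SizeBound (· = 4 * D) (J + D + (I + 2 * M)) (F y m) := by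
    intro y m
    have hd := y.2.2.1.2
    have h1 := ((((sizeBound_auxMonomial y.2).legendreD_iterate m).X_pow_mul
      (2 * (D - y.2.2.1))).C_mul (α ^ (y.1 : ℕ) * δ ^ (J - y.1) *
      (C κ ^ (D + y.2.2.1) * δ ^ (D - y.2.2.1))))
    refine (h1.mono ?_).weaken fun k hk => by omega
    refine Nat.add_le_add ?_ (by have := m.2; omega)
    have hα' := natDegree_pow_le_of_le y.1 hα
    have hδ' := natDegree_pow_le_of_le (J - y.1) hδ
    have hδ'' := natDegree_pow_le_of_le (D - y.2.2.1) hδ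
    have hκ' : (C κ ^ (D + y.2.2.1 : ℕ)).natDegree = 0 := by
      rw [← C_pow, natDegree_C]
    have h2 := y.1.2
    refine natDegree_mul_le.trans (Nat.add_le_add (natDegree_mul_le.trans ?_)
      (natDegree_mul_le.trans ?_)) <;> omega
  have hcard : Fintype.card (Fin M) * ((4 * D + 1) * (J + D + (I + 2 * M) + 1)) <
      Fintype.card (Fin J × (Fin (I + 1) × Fin D × Fin (2 * D))) := by
    simp only [Fintype.card_prod, Fintype.card_fin]
    have h1 : 4 * D + 1 ≤ 17 * v := by omega
    have h2 : J + D + (I + 2 * M) + 1 ≤ 29 * v ^ 2 := by omega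
    calc M * ((4 * D + 1) * (J + D + (I + 2 * M) + 1))
        ≤ 2 * v ^ 2 * (17 * v * (29 * v ^ 2)) := by
          rw [← hM]
          exact Nat.mul_le_mul_left _ (Nat.mul_le_mul h1 h2)
      _ = 986 * v ^ 5 := by ring
      _ < 2048 * v ^ 5 := Nat.mul_lt_mul_of_pos_right (by norm_num) (by positivity)
      _ = 4 * v * (16 * v ^ 2 * (4 * v * (2 * (4 * v)))) := by ring
      _ ≤ J * ((I + 1) * (D * (2 * D))) := by
          rw [hJ, hD, hI]
          exact Nat.mul_le_mul_left _ (Nat.mul_le_mul_right _ (Nat.le_succ _))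
  obtain ⟨c, hc0, hc⟩ := exists_smul_sum_eq_zero F hF hcard
  set Ψ : K[X] := ∑ y : Fin J × (Fin (I + 1) × Fin D × Fin (2 * D)),
    c y • (X ^ (p * (y.1 : ℕ)) * pairEval h G (auxMonomial K D y.2)) with hΨ
  have hpairsmul : ∀ (a : K) (Q : MvPolynomial (Fin 2) K[X]),
      pairEval h G (a • Q) = a • pairEval h G Q := fun a Q =>
    (pairEval h G).map_smul_of_tower a Q
  have hΨ0 : Ψ ≠ 0 := by
    have hΨ' : Ψ = ∑ j : Fin J, X ^ (p * (j : ℕ)) *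
        pairEval h G (∑ x, c (j, x) • auxMonomial K D x) := by
      rw [hΨ, Fintype.sum_prod_type]
      refine Finset.sum_congr rfl fun j _ => ?_
      rw [map_sum, Finset.mul_sum]
      refine Finset.sum_congr rfl fun x _ => ?_
      rw [hpairsmul, mul_smul_comm]
    have hze : ∀ P : MvPolynomial (Fin 2) K[X], P ≠ 0 → SizeBound (· ≤ 4 * D) I P →
        ¬ X ^ p ∣ pairEval h G P := by
      intro P hP hPs
      refine not_X_pow_dvd_pairEval p hh hG h0 hcop hP hPs (by omega) ?_ (by omega)
      have h1 : (4 * D + 1) ^ 2 ≤ 289 * v ^ 2 := by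
        calc (4 * D + 1) ^ 2 ≤ (17 * v) ^ 2 := Nat.pow_le_pow_left (by omega) 2
          _ = 289 * v ^ 2 := by ring
      have h2 : ((4 * D + 1) ^ 2 + 1) * (I + 2 * (4 * D + 1) ^ 2) ≤ 290 * v ^ 2 * (594 * v ^ 2) :=
        Nat.mul_le_mul (by omega) (by omega)
      have h3 : 290 * v ^ 2 * (594 * v ^ 2) = 172260 * v ^ 4 := by ring
      omega
    have hsb : ∀ j : Fin J, SizeBound (· ≤ 4 * D) I (∑ x, c (j, x) • auxMonomial K D x) :=
      fun j => SizeBound.sum _ _ fun x _ => ((sizeBound_auxMonomial x).smul _).weaken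
        fun k hk => by
          have := x.2.1.2
          omega
    rw [hΨ']
    obtain ⟨⟨j₀, x₀⟩, hy⟩ := Function.ne_iff.1 hc0
    have hP : (∑ x, c (j₀, x) • auxMonomial K D x) ≠ 0 :=
      sum_auxMonomial_ne_zero (Function.ne_iff.2 ⟨x₀, hy⟩)
    refine sum_X_pow_mul_ne_zero (fun j => ?_) (j₀ := j₀) ?_
    · by_cases hj : (∑ x, c (j, x) • auxMonomial K D x) = 0
      · left
        rw [hj, map_zero]
      · exact Or.inr (hze _ hj (hsb j))
    · intro hz
      refine hze _ hP (hsb j₀) ?_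
      rw [hz]
      exact dvd_zero _
  have hdvd : ∀ t ∈ Λ, (X - C t) ^ M ∣ Ψ := by
    intro t ht
    obtain ⟨ht0, ht1, hδt, hαt, hκt⟩ := hΛ t ht
    refine X_sub_C_pow_dvd_of_logTheta p ht0 ht1 (by omega) fun m hm => ?_
    have h1 := congrArg (fun Q => (pairEval h G Q).eval t) (hc ⟨m, hm⟩)
    simp only [map_sum, hpairsmul, map_zero, eval_zero, eval_finsetSum, eval_smul, smul_eq_mul] at h1
    have h2 : κ ^ (2 * D) * δ.eval t ^ J * ((logTheta K)^[m] Ψ).eval t = 0 := by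
      rw [← h1, hΨ, logTheta_iterate_sum_smul, eval_finsetSum, Finset.mul_sum]
      refine Finset.sum_congr rfl fun y _ => ?_
      rw [logTheta_iterate_X_pow_mul, ← pairEval_legendreD_iterate hh hG, eval_smul, smul_eq_mul,
        eval_mul, eval_pow, eval_X, mul_left_comm,
        ← stepanov_eval_aux y.1.2 y.2.2.1.2 hαt hκt]
      congr 1
      have h3 : ∀ q : K[X], pairEval h G (MvPolynomial.C q) = q := fun q => by simp [pairEval]
      have h4 : pairEval h G (MvPolynomial.X 0) = h := by simp [pairEval]
      simp only [F]
      rw [map_mul, h3, map_mul, map_pow, h4]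
      simp only [eval_mul, eval_pow, eval_C]
    exact (mul_eq_zero.1 h2).resolve_left
      (mul_ne_zero (pow_ne_zero _ hκ) (pow_ne_zero _ hδt))
  have hΨdeg : Ψ.natDegree ≤ p * J + (I + 4 * D * (n + 1)) := by
    refine natDegree_sum_le_of_forall_le _ _ fun y _ => ?_
    refine (natDegree_smul_le _ _).trans (natDegree_mul_le.trans (Nat.add_le_add ?_ ?_))
    · rw [natDegree_X_pow]
      exact Nat.mul_le_mul_left _ y.1.2.le
    · refine natDegree_pairEval_auxMonomial hn.le ?_ y.2
      rw [← hh]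
      exact (natDegree_logTheta_le h).trans (by omega)
  have h1 := (card_mul_le_natDegree hΨ0 hdvd).trans hΨdeg
  have h2 : p * J + (I + 4 * D * (n + 1)) ≤ 22 * p * v := by
    rw [hJ, hD, hI]
    have e1 : 16 * v ^ 2 ≤ p * v := by
      nlinarith
    have e2 : v * (n + 1) ≤ v * p := Nat.mul_le_mul_left _ (by omega)
    nlinarith
  rw [hM] at h1
  have h3 : (Λ.card * v) * (2 * v) ≤ (11 * p) * (2 * v) := by nlinarith
  exact Nat.le_of_mul_le_mul_right h3 (by omega)

end Stepanov

section HasseInvariant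

theorem ZMod.sum_range_natCast {M : Type*} [AddCommMonoid M] (p : ℕ) [NeZero p] (g : ZMod p → M) :
    ∑ i ∈ Finset.range p, g i = ∑ u, g u := by
  refine Finset.sum_nbij' (fun i => (i : ZMod p)) ZMod.val ?_ ?_ ?_ ?_ ?_
  · simp
  · exact fun u _ => Finset.mem_range.2 u.val_lt
  · exact fun i hi => ZMod.val_cast_of_lt (Finset.mem_range.1 hi)
  · exact fun u _ => ZMod.natCast_zmod_val u
  · simp

theorem ZMod.sum_pow_eq (p : ℕ) [Fact p.Prime] {k : ℕ} (hk : k < 2 * (p - 1)) :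
    ∑ x : ZMod p, x ^ k = if k = p - 1 then -1 else 0 := by
  have hp := (Fact.out : p.Prime).two_le
  split_ifs with h
  · subst h
    rw [← Finset.add_sum_erase _ _ (Finset.mem_univ (0 : ZMod p)), zero_pow (by omega), zero_add,
      Finset.sum_congr rfl fun x hx => ZMod.pow_card_sub_one_eq_one (Finset.ne_of_mem_erase hx)]
    rw [Finset.sum_const, Finset.card_erase_of_mem (Finset.mem_univ _), Finset.card_univ, ZMod.card,
      nsmul_one, Nat.cast_sub (by omega)]
    simp
  · rcases lt_or_gt_of_ne h with hlt | hgt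
    · exact FiniteField.sum_pow_lt_card_sub_one (K := ZMod p) k (by rwa [ZMod.card])
    · obtain ⟨m, rfl⟩ : ∃ m, k = m + p := ⟨k - p, by omega⟩
      simp only [pow_add _ m p, ZMod.pow_card, ← pow_succ]
      exact FiniteField.sum_pow_lt_card_sub_one (K := ZMod p) (m + 1) (by rw [ZMod.card]; omega)

theorem ZMod.sum_eval_eq (p : ℕ) [Fact p.Prime] {f : (ZMod p)[X]} (hf : f.natDegree < 2 * (p - 1)) :
    ∑ x, f.eval x = -f.coeff (p - 1) := by
  simp only [eval_eq_sum_range' hf]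
  rw [Finset.sum_comm, Finset.sum_congr rfl fun k hk => by
    rw [← Finset.mul_sum, ZMod.sum_pow_eq p (Finset.mem_range.1 hk)]]
  have hp := (Fact.out : p.Prime).two_le
  rw [Finset.sum_eq_single (p - 1)]
  · simp
  · intro k _ hk
    rw [if_neg hk, mul_zero]
  · intro h
    exact absurd (Finset.mem_range.2 (by omega)) h

theorem affinePoints_cast (p : ℕ) [Fact p.Prime] (hp2 : p ≠ 2) (a b : ZMod p) :
    (affinePoints p a b : ZMod p) = ∑ x : ZMod p, ((x ^ 3 + a * x + b) ^ (p / 2) + 1) := by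
  have h1 : affinePoints p a b = ∑ x : ZMod p, ∑ y : ZMod p,
      if y ^ 2 = x ^ 3 + a * x + b then 1 else 0 := by
    rw [affinePoints, Finset.card_filter, Finset.sum_product,
      ← ZMod.sum_range_natCast p fun x => ∑ y : ZMod p, if y ^ 2 = x ^ 3 + a * x + b then 1 else 0]
    exact Finset.sum_congr rfl fun x _ =>
      ZMod.sum_range_natCast p fun y => if y ^ 2 = (x : ZMod p) ^ 3 + a * x + b then 1 else 0
  rw [h1, Nat.cast_sum]
  refine Finset.sum_congr rfl fun x _ => ?_
  have hF : ringChar (ZMod p) ≠ 2 := by rwa [ZMod.ringChar_zmod_n]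
  have h2 := quadraticChar_card_sqrts hF (x ^ 3 + a * x + b)
  have h3 := quadraticChar_eq_pow_of_char_ne_two' hF (x ^ 3 + a * x + b)
  rw [ZMod.card] at h3
  rw [← h3, ← Finset.card_filter]
  have h4 := congrArg (Int.cast (R := ZMod p)) h2
  push_cast at h4
  rw [← h4]
  congr 2
  ext y
  simp

theorem trace_cast_eq_coeff (p : ℕ) [Fact p.Prime] (hp2 : p ≠ 2) (a b : ZMod p) :
    (((p : ℤ) - affinePoints p a b : ℤ) : ZMod p) =
      ((X ^ 3 + C a * X + C b : (ZMod p)[X]) ^ (p / 2)).coeff (p - 1) := by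
  have hp := (Fact.out : p.Prime)
  have hodd := hp.eq_two_or_odd.resolve_left hp2
  have h3 := hp.two_le
  push_cast
  rw [affinePoints_cast p hp2, Finset.sum_add_distrib]
  have h1 : ((X ^ 3 + C a * X + C b : (ZMod p)[X]) ^ (p / 2)).natDegree < 2 * (p - 1) := by
    refine (natDegree_pow_le_of_le (p / 2) (m := 3) (by compute_degree)).trans_lt ?_
    omega
  have h2 := ZMod.sum_eval_eq p h1
  simp only [eval_pow, eval_add, eval_mul, eval_X, eval_C] at h2
  rw [h2]
  simp

variable {K : Type*} [Field K]

theorem coeff_taylor_prime_sub_one (p : ℕ) [Fact p.Prime] [CharP K p] {f : K[X]}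
    (hf : f.natDegree < 2 * p - 1) (e : K) : (taylor e f).coeff (p - 1) = f.coeff (p - 1) := by
  have hp := (Fact.out : p.Prime)
  have h2 := hp.two_le
  have h : hasseDeriv (p - 1) f = C (f.coeff (p - 1)) := by
    ext m
    rw [hasseDeriv_coeff, coeff_C]
    split_ifs with hm
    · simp [hm]
    · by_cases hmp : m < p
      · have := hp.dvd_choose_add (a := p - 1) (b := m) (by omega) hmp (by omega)
        rw [add_comm] at this
        rw [(CharP.cast_eq_zero_iff K p _).2 this, zero_mul]
      · rw [coeff_eq_zero_of_natDegree_lt (by omega), mul_zero]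
  rw [taylor_coeff, h, eval_C]

theorem coeff_mul_X_sub_C_pow (n : ℕ) (u w : K) :
    ((X - C u) ^ n * (X - C w) ^ n).coeff n =
      (-1) ^ n * ∑ i ∈ Finset.range (n + 1), (n.choose i : K) ^ 2 * (u ^ (n - i) * w ^ i) := by
  rw [coeff_mul, Finset.Nat.sum_antidiagonal_eq_sum_range_succ_mk, Finset.mul_sum]
  refine Finset.sum_congr rfl fun i hi => ?_
  have hin : i ≤ n := Nat.lt_succ_iff.1 (Finset.mem_range.1 hi)
  dsimp only
  rw [sub_eq_add_neg, sub_eq_add_neg, ← C_neg, ← C_neg, coeff_X_add_C_pow, coeff_X_add_C_pow,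
    Nat.choose_symm hin, Nat.sub_sub_self hin,
    neg_pow u, neg_pow w]
  have : (-1 : K) ^ n = (-1) ^ (n - i) * (-1) ^ i := by rw [← pow_add, Nat.sub_add_cancel hin]
  rw [this]
  ring

theorem coeff_cubic_pow (p : ℕ) [Fact p.Prime] [CharP K p] {n : ℕ} (hp : p = 2 * n + 1)
    {e₁ e₂ e₃ : K} (h12 : e₁ ≠ e₂) :
    (((X - C e₁) * (X - C e₂) * (X - C e₃)) ^ n).coeff (p - 1) =
      (-1) ^ n * (e₂ - e₁) ^ n * (hassePoly K n).eval ((e₃ - e₁) / (e₂ - e₁)) := by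
  have hu : e₂ - e₁ ≠ 0 := sub_ne_zero.2 h12.symm
  have hdeg : (((X - C e₁) * (X - C e₂) * (X - C e₃)) ^ n).natDegree ≤ n * 3 :=
    natDegree_pow_le_of_le n (by compute_degree)
  have hn : n ≠ 0 := by
    rintro rfl
    exact (Fact.out : p.Prime).one_lt.ne' hp
  rw [← coeff_taylor_prime_sub_one p (by omega) e₁, taylor_apply]
  have h1 : (((X - C e₁) * (X - C e₂) * (X - C e₃)) ^ n).comp (X + C e₁) =
      ((X - C (e₂ - e₁)) ^ n * (X - C (e₃ - e₁)) ^ n) * X ^ n := by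
    simp only [pow_comp, mul_comp, sub_comp, X_comp, C_comp, C_sub]
    rw [← mul_pow, ← mul_pow]
    ring
  rw [h1, show p - 1 = n + n by omega, coeff_mul_X_pow, coeff_mul_X_sub_C_pow, hassePoly,
    eval_finsetSum, mul_assoc, Finset.mul_sum (a := (e₂ - e₁) ^ n)]
  congr 1
  refine Finset.sum_congr rfl fun i hi => ?_
  have hin : i ≤ n := Nat.lt_succ_iff.1 (Finset.mem_range.1 hi)
  simp only [eval_mul, eval_C, eval_pow, eval_X, div_pow]
  rw [← Nat.sub_add_cancel hin, pow_add, Nat.sub_add_cancel hin]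
  field_simp

end HasseInvariant

section LegendreParameter

variable {K : Type*} [Field K]

/-- The three relations between `t ^ p`, the Hasse polynomial and the Frobenius trace `c`,
according to the action of Frobenius on the roots of the cubic. -/
def IsLegendreTrace (p n : ℕ) (c t : K) : Prop :=
  (t ^ p = t ∧ (hassePoly K n).eval t ^ 2 = c ^ 2) ∨
  (t ^ p = 1 - t ∧ (hassePoly K n).eval t ^ 2 = -c ^ 2) ∨
  ((1 - t) * t ^ p = 1 ∧ (1 - t) * (hassePoly K n).eval t ^ 2 = -c ^ 2)

/-- The conclusion of the Legendre parametrization of a cubic `X³ + aX + b`. -/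
def HasLegendreParam (p n : ℕ) (c a b t : K) : Prop :=
  t ≠ 0 ∧ t ≠ 1 ∧ IsLegendreTrace p n c t ∧
    ∃ u : K, u ≠ 0 ∧ a = u ^ 2 * (-(t ^ 2 - t + 1) / 3) ∧
      b = u ^ 3 * ((1 + t) * (2 - t) * (2 * t - 1) / 27)

theorem cubic_coeffs {a b e₁ e₂ e₃ : K}
    (h : (X ^ 3 + C a * X + C b : K[X]) = (X - C e₁) * (X - C e₂) * (X - C e₃)) :
    e₁ + e₂ + e₃ = 0 ∧ a = e₁ * e₂ + e₁ * e₃ + e₂ * e₃ ∧ b = -(e₁ * e₂ * e₃) := by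
  have h1 : (X - C e₁) * (X - C e₂) * (X - C e₃) = X ^ 3 - C (e₁ + e₂ + e₃) * X ^ 2 +
      C (e₁ * e₂ + e₁ * e₃ + e₂ * e₃) * X + C (-(e₁ * e₂ * e₃)) := by
    simp only [C_add, C_mul, C_neg]
    ring
  rw [h1] at h
  have c0 := congrArg (fun f => f.coeff 0) h
  have c1 := congrArg (fun f => f.coeff 1) h
  have c2 := congrArg (fun f => f.coeff 2) h
  simp [coeff_X, coeff_C, -map_neg, -map_add, -map_mul] at c0 c1 c2
  refine ⟨?_, c1, c0⟩
  linear_combination c2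

theorem hasLegendreParam_of_frobenius (p : ℕ) [Fact p.Prime] [CharP K p] {n : ℕ}
    (hpn : p = 2 * n + 1) (h3 : (3 : K) ≠ 0) {a b c e₁ e₂ e₃ : K}
    (hf : (X ^ 3 + C a * X + C b : K[X]) = (X - C e₁) * (X - C e₂) * (X - C e₃))
    (hc : c = ((X ^ 3 + C a * X + C b : K[X]) ^ n).coeff (p - 1))
    (h12 : e₁ ≠ e₂) (h13 : e₁ ≠ e₃) (h23 : e₂ ≠ e₃)
    (hσ : (e₁ ^ p = e₁ ∧ e₂ ^ p = e₂ ∧ e₃ ^ p = e₃) ∨ (e₁ ^ p = e₂ ∧ e₂ ^ p = e₁ ∧ e₃ ^ p = e₃) ∨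
      (e₁ ^ p = e₂ ∧ e₂ ^ p = e₃ ∧ e₃ ^ p = e₁)) :
    ∃ t, HasLegendreParam p n c a b t := by
  have hu : e₂ - e₁ ≠ 0 := sub_ne_zero.2 h12.symm
  obtain ⟨s0, s1, s2⟩ := cubic_coeffs hf
  rw [hf, coeff_cubic_pow p hpn h12] at hc
  obtain ⟨u, hudef⟩ : ∃ u, u = e₂ - e₁ := ⟨_, rfl⟩
  rw [← hudef] at hu hc
  obtain ⟨t, ht⟩ : ∃ t, t = (e₃ - e₁) / u := ⟨_, rfl⟩
  rw [← ht] at hc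
  have htu : t * u = e₃ - e₁ := by rw [ht]; field_simp
  have hc2 : c ^ 2 * u = u ^ p * (hassePoly K n).eval t ^ 2 := by
    rw [hc, hpn, mul_pow, mul_pow, ← pow_mul, mul_comm n 2, pow_mul, neg_one_sq, one_pow]
    ring
  have hup : u ^ p = e₂ ^ p - e₁ ^ p := by
    rw [hudef, sub_pow_expChar]
  have htp : t ^ p * u ^ p = e₃ ^ p - e₁ ^ p := by
    rw [← mul_pow, htu, sub_pow_expChar]
  refine ⟨t, ?_, ?_, ?_, u, hu, ?_, ?_⟩
  · rw [ht]
    exact div_ne_zero (sub_ne_zero.2 h13.symm) hu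
  · intro h1
    rw [h1, one_mul] at htu
    exact h23 (by linear_combination htu - hudef)
  · rcases hσ with ⟨q1, q2, q3⟩ | ⟨q1, q2, q3⟩ | ⟨q1, q2, q3⟩
    · have hup' : u ^ p = u := by rw [hup, q1, q2, hudef]
      left
      rw [hup'] at htp hc2
      refine ⟨mul_right_cancel₀ hu ?_, mul_right_cancel₀ hu ?_⟩
      · rw [htp, htu, q1, q3]
      · rw [hc2]
        ring
    · have hup' : u ^ p = -u := by rw [hup, q1, q2, hudef]; ring
      right; left
      rw [hup'] at htp hc2
      refine ⟨mul_right_cancel₀ hu ?_, mul_right_cancel₀ hu ?_⟩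
      · rw [q1, q3] at htp
        linear_combination -htp + htu - hudef
      · linear_combination hc2
    · have hup' : u ^ p = u * (t - 1) := by rw [hup, q1, q2]; linear_combination hudef - htu
      right; right
      rw [hup'] at htp hc2
      refine ⟨mul_right_cancel₀ hu ?_, mul_right_cancel₀ hu ?_⟩
      · rw [q1, q3] at htp
        linear_combination -htp - hudef
      · linear_combination hc2
  · have e1 : 3 * e₁ = -(1 + t) * u := by linear_combination s0 + hudef + htu
    have e2 : e₂ = e₁ + u := by rw [hudef]; ring
    have e3 : e₃ = e₁ + t * u := by rw [htu]; ring
    rw [s1, e2, e3]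
    field_simp
    linear_combination (3 * e₁ + (1 + t) * u) * e1
  · have e1 : 3 * e₁ = -(1 + t) * u := by linear_combination s0 + hudef + htu
    have e1' : e₁ = -(1 + t) * u / 3 := by rw [← e1]; field_simp
    have e2 : e₂ = e₁ + u := by rw [hudef]; ring
    have e3 : e₃ = e₁ + t * u := by rw [htu]; ring
    have h27 : (27 : K) ≠ 0 := by
      rw [show (27 : K) = 3 ^ 3 by norm_num]
      exact pow_ne_zero _ h3
    rw [s2, e2, e3, e1']
    field_simp
    ring

theorem disc_eq_zero_of_eq {a b e₁ e₂ e₃ : K}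
    (hf : (X ^ 3 + C a * X + C b : K[X]) = (X - C e₁) * (X - C e₂) * (X - C e₃))
    (h : e₁ = e₂) : 4 * a ^ 3 + 27 * b ^ 2 = 0 := by
  obtain ⟨s0, rfl, rfl⟩ := cubic_coeffs hf
  have h3 : e₃ = -2 * e₂ := by linear_combination s0 - h
  rw [h, h3]
  ring

theorem exists_hasLegendreParam [IsAlgClosed K] (p : ℕ) [Fact p.Prime] [Algebra (ZMod p) K]
    [CharP K p] {n : ℕ} (hpn : p = 2 * n + 1) (h3 : (3 : K) ≠ 0) {a b : ZMod p}
    (hD : 4 * a ^ 3 + 27 * b ^ 2 ≠ 0) :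
    ∃ t, HasLegendreParam p n (((p : ℤ) - affinePoints p a b : ℤ) : K)
      (algebraMap (ZMod p) K a) (algebraMap (ZMod p) K b) t := by
  have hp2 : p ≠ 2 := by omega
  set φ := algebraMap (ZMod p) K with hφ
  have hDK : 4 * φ a ^ 3 + 27 * φ b ^ 2 ≠ 0 := by
    intro h
    apply hD
    apply φ.injective
    rw [map_add, map_mul, map_mul, map_pow, map_pow, map_zero,
      map_ofNat φ 4, map_ofNat φ 27]
    exact h
  set f : K[X] := X ^ 3 + C (φ a) * X + C (φ b) with hfdef
  have hdeg : f.natDegree = 3 := by rw [hfdef]; compute_degree!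
  have hmonic : f.Monic := by rw [hfdef]; monicity!
  have hspl : f.Splits := IsAlgClosed.splits f
  have hcard : f.roots.card = 3 := by rw [← hdeg]; exact hspl.natDegree_eq_card_roots.symm
  obtain ⟨e₁, e₂, e₃, hr⟩ := Multiset.card_eq_three.1 hcard
  have hf : f = (X - C e₁) * (X - C e₂) * (X - C e₃) := by
    conv_lhs => rw [hspl.eq_prod_roots_of_monic hmonic, hr]
    simp [mul_assoc]
  have hf' : f = (X - C e₁) * (X - C e₃) * (X - C e₂) := by rw [hf]; ring
  have hf'' : f = (X - C e₂) * (X - C e₃) * (X - C e₁) := by rw [hf]; ring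
  have h12 : e₁ ≠ e₂ := fun h => hDK (disc_eq_zero_of_eq hf h)
  have h13 : e₁ ≠ e₃ := fun h => hDK (disc_eq_zero_of_eq hf' h)
  have h23 : e₂ ≠ e₃ := fun h => hDK (disc_eq_zero_of_eq hf'' h)
  have hroot : ∀ e, f.eval e = 0 ↔ e = e₁ ∨ e = e₂ ∨ e = e₃ := by
    intro e
    rw [hf]
    simp [sub_eq_zero, or_assoc]
  have hfrob : ∀ e, f.eval e = 0 → f.eval (e ^ p) = 0 := by
    intro e he
    have h : f.eval (e ^ p) = (f.eval e) ^ p := by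
      simp only [hfdef, eval_add, eval_mul, eval_pow, eval_X, eval_C]
      rw [add_pow_expChar, add_pow_expChar, mul_pow, ← map_pow φ a, ← map_pow φ b,
        ZMod.pow_card, ZMod.pow_card, ← pow_mul, ← pow_mul, mul_comm 3 p]
    rw [h, he, zero_pow (Fact.out : p.Prime).ne_zero]
  have hinj : ∀ x y : K, x ^ p = y ^ p → x = y := by
    intro x y h
    exact frobenius_inj K p (by simpa [frobenius_def] using h)
  have hc : (((p : ℤ) - affinePoints p a b : ℤ) : K) = (f ^ n).coeff (p - 1) := by
    have h := congrArg φ (trace_cast_eq_coeff p hp2 a b)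
    rw [map_intCast, ← coeff_map, show p / 2 = n by omega] at h
    rw [h]
    simp [hfdef, hφ]
  have k1 := (hroot _).1 (hfrob e₁ ((hroot _).2 (by simp)))
  have k2 := (hroot _).1 (hfrob e₂ ((hroot _).2 (by simp)))
  have k3 := (hroot _).1 (hfrob e₃ ((hroot _).2 (by simp)))
  have n12 : e₁ ^ p ≠ e₂ ^ p := fun h => h12 (hinj _ _ h)
  have n13 : e₁ ^ p ≠ e₃ ^ p := fun h => h13 (hinj _ _ h)
  have n23 : e₂ ^ p ≠ e₃ ^ p := fun h => h23 (hinj _ _ h)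
  have core₁ := hasLegendreParam_of_frobenius p hpn h3 hf hc h12 h13 h23
  have core₂ := hasLegendreParam_of_frobenius p hpn h3 hf' hc h13 h12 h23.symm
  have core₃ := hasLegendreParam_of_frobenius p hpn h3 hf'' hc h23 h12.symm h13.symm
  rcases k1 with k1 | k1 | k1 <;> rcases k2 with k2 | k2 | k2 <;>
    rcases k3 with k3 | k3 | k3 <;>
    first
    | exact absurd (k1.trans k2.symm) n12
    | exact absurd (k1.trans k3.symm) n13
    | exact absurd (k2.trans k3.symm) n23
    | exact core₁ (.inl ⟨k1, k2, k3⟩)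
    | exact core₁ (.inr (.inl ⟨k1, k2, k3⟩))
    | exact core₁ (.inr (.inr ⟨k1, k2, k3⟩))
    | exact core₂ (.inr (.inl ⟨k1, k3, k2⟩))
    | exact core₂ (.inr (.inr ⟨k1, k3, k2⟩))
    | exact core₃ (.inr (.inl ⟨k2, k3, k1⟩))

end LegendreParameter

section LegendreCount

variable {K : Type*} [Field K]

theorem card_mul_le_of_isLegendreTrace [IsAlgClosed K] (p : ℕ) [Fact p.Prime] [CharP K p]
    {n : ℕ} (hpn : p = 2 * n + 1) (h4 : (4 : K) ≠ 0) {c : K} (hc : c ≠ 0) {Λ : Finset K}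
    (hΛ : ∀ t ∈ Λ, t ≠ 0 ∧ t ≠ 1 ∧ IsLegendreTrace p n c t)
    {v : ℕ} (hv : 1 ≤ v) (hvp : 400000 * v ^ 4 ≤ p) : Λ.card * v ≤ 33 * p := by
  classical
  have key {Λ' : Finset K} {α δ : K[X]} (hα : α.natDegree ≤ 1) (hδ : δ.natDegree ≤ 1) {κ : K}
      (hκ : κ ≠ 0) (hΛ' : ∀ t ∈ Λ', t ≠ 0 ∧ t ≠ 1 ∧ δ.eval t ≠ 0 ∧ δ.eval t * t ^ p = α.eval t ∧
      δ.eval t * (hassePoly K n).eval t ^ 2 = κ) : Λ'.card * v ≤ 11 * p :=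
    card_mul_le_of_legendre p rfl (logTheta_logTheta_hassePoly p hpn h4)
      (by rw [eval_zero_hassePoly]; exact one_ne_zero) (isCoprime_hassePoly p hpn h4)
      (natDegree_hassePoly n) hpn hα hδ hκ hΛ' hv hvp
  have hc2 : c ^ 2 ≠ 0 := pow_ne_zero 2 hc
  have hdeg : (1 - X : K[X]).natDegree ≤ 1 := by compute_degree
  have b1 := key (Λ' := Λ.filter fun t => t ^ p = t ∧ (hassePoly K n).eval t ^ 2 = c ^ 2)
    (α := X) (δ := 1) natDegree_X_le (by simp) hc2 (by
      intro t ht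
      obtain ⟨ht, h1, h2⟩ := Finset.mem_filter.1 ht
      obtain ⟨k0, k1, -⟩ := hΛ t ht
      simp [k0, k1, h1, h2])
  have b2 := key (Λ' := Λ.filter fun t => t ^ p = 1 - t ∧ (hassePoly K n).eval t ^ 2 = -c ^ 2)
    (α := 1 - X) (δ := 1) hdeg (by simp) (neg_ne_zero.2 hc2) (by
      intro t ht
      obtain ⟨ht, h1, h2⟩ := Finset.mem_filter.1 ht
      obtain ⟨k0, k1, -⟩ := hΛ t ht
      simp [k0, k1, h1, h2])
  have b3 := key
    (Λ' := Λ.filter fun t => (1 - t) * t ^ p = 1 ∧ (1 - t) * (hassePoly K n).eval t ^ 2 = -c ^ 2)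
    (α := 1) (δ := 1 - X) (by simp) hdeg (neg_ne_zero.2 hc2) (by
      intro t ht
      obtain ⟨ht, h1, h2⟩ := Finset.mem_filter.1 ht
      obtain ⟨k0, k1, -⟩ := hΛ t ht
      simp [k0, k1, h1, h2, sub_eq_zero, Ne.symm k1])
  have hsub : Λ ⊆ (Λ.filter fun t => t ^ p = t ∧ (hassePoly K n).eval t ^ 2 = c ^ 2) ∪
      ((Λ.filter fun t => t ^ p = 1 - t ∧ (hassePoly K n).eval t ^ 2 = -c ^ 2) ∪
      (Λ.filter fun t => (1 - t) * t ^ p = 1 ∧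
        (1 - t) * (hassePoly K n).eval t ^ 2 = -c ^ 2)) := by
    intro t ht
    simp only [Finset.mem_union, Finset.mem_filter, ht, true_and]
    exact (hΛ t ht).2.2
  have hle := (Finset.card_le_card hsub).trans ((Finset.card_union_le _ _).trans
    (Nat.add_le_add_left (Finset.card_union_le _ _) _))
  have := Nat.mul_le_mul_right v hle
  rw [add_mul, add_mul] at this
  omega

end LegendreCount

theorem exists_minor_ne_zero {A B : ℤ[X]} (hΔ : 4 * A ^ 3 + 27 * B ^ 2 ≠ 0)
    (hj : jNonconstant A B) :
    ∃ i j, (A ^ 3).coeff i * (B ^ 2).coeff j - (A ^ 3).coeff j * (B ^ 2).coeff i ≠ 0 := by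
  by_contra! h
  obtain ⟨i, hi⟩ : ∃ i, (4 * A ^ 3 + 27 * B ^ 2).coeff i ≠ 0 := by
    by_contra! h0
    exact hΔ (Polynomial.ext (by simpa using h0))
  have e (j : ℕ) : (4 * A ^ 3 + 27 * B ^ 2).coeff j =
      4 * (A ^ 3).coeff j + 27 * (B ^ 2).coeff j := by
    rw [coeff_add, ← C_ofNat, ← C_ofNat, coeff_C_mul, coeff_C_mul]
  rw [e] at hi
  have hiQ : (4 * ((A ^ 3).coeff i : ℚ) + 27 * ((B ^ 2).coeff i : ℚ)) ≠ 0 := by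
    exact_mod_cast hi
  apply hj (-6912 * (A ^ 3).coeff i / (4 * (A ^ 3).coeff i + 27 * (B ^ 2).coeff i))
  rw [← Polynomial.map_pow, ← Polynomial.map_pow]
  ext j
  have h' : ((A ^ 3).coeff i : ℚ) * (B ^ 2).coeff j - (A ^ 3).coeff j * (B ^ 2).coeff i = 0 := by
    exact_mod_cast h i j
  rw [coeff_C_mul, coeff_add, neg_mul, coeff_neg, ← map_ofNat C 6912, ← map_ofNat C 4,
    ← map_ofNat C 27, coeff_C_mul, coeff_C_mul, coeff_C_mul]
  simp only [coeff_map, eq_intCast]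
  rw [div_mul_eq_mul_div, eq_div_iff hiQ]
  linear_combination (6912 * 27 : ℚ) * h'

/-- The residues `t` modulo `p` at which `Y² = X³ + A(t)X + B(t)` is nonsingular with trace of
Frobenius equal to `a`. -/
noncomputable def traceResidues (A B : ℤ[X]) (a : ℤ) (p : ℕ) [NeZero p] : Finset (ZMod p) :=
  Finset.univ.filter fun t =>
    4 * (A.map (Int.castRingHom (ZMod p))).eval t ^ 3 +
      27 * (B.map (Int.castRingHom (ZMod p))).eval t ^ 2 ≠ 0 ∧
    (p : ℤ) - affinePoints p ((A.map (Int.castRingHom (ZMod p))).eval t)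
      ((B.map (Int.castRingHom (ZMod p))).eval t) = a

theorem card_filter_proportional_le {F : Type*} [Field F] {P Q : F[X]} {i j d : ℕ}
    (hij : P.coeff i * Q.coeff j - P.coeff j * Q.coeff i ≠ 0) (hP : P.natDegree ≤ d)
    (hQ : Q.natDegree ≤ d) {x y : F} (hxy : ¬ (x = 0 ∧ y = 0)) {S : Finset F}
    (hS : ∀ t ∈ S, P.eval t * y = x * Q.eval t) : S.card ≤ d := by
  have hR : C y * P - C x * Q ≠ 0 := by
    intro h
    have hk (k : ℕ) : y * P.coeff k = x * Q.coeff k := by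
      have := congrArg (fun f => f.coeff k) h
      simpa [sub_eq_zero] using this
    refine hxy ⟨?_, ?_⟩
    · refine (mul_eq_zero.1 (?_ : x * _ = 0)).resolve_right hij
      linear_combination P.coeff j * hk i - P.coeff i * hk j
    · refine (mul_eq_zero.1 (?_ : y * _ = 0)).resolve_right hij
      linear_combination Q.coeff j * hk i - Q.coeff i * hk j
  have hroots : S.val ⊆ (C y * P - C x * Q).roots := by
    intro t ht
    rw [mem_roots hR, IsRoot, eval_sub, eval_mul, eval_mul, eval_C, eval_C]
    linear_combination hS t ht
  refine (card_le_degree_of_subset_roots hroots).trans ?_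
  exact (natDegree_sub_le_of_le ((natDegree_C_mul_le _ _).trans hP)
    ((natDegree_C_mul_le _ _).trans hQ)).trans (by simp)

theorem card_traceResidues_mul_le {A B : ℤ[X]} {a : ℤ} {i j : ℕ} (p : ℕ) [Fact p.Prime]
    (ha : ¬ (p : ℤ) ∣ a)
    (hm : ¬ (p : ℤ) ∣ (A ^ 3).coeff i * (B ^ 2).coeff j - (A ^ 3).coeff j * (B ^ 2).coeff i)
    {v : ℕ} (hv : 1 ≤ v) (hvp : 400000 * v ^ 4 ≤ p) :
    (traceResidues A B a p).card * v ≤ 33 * (3 * A.natDegree + 2 * B.natDegree) * p := by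
  classical
  have hprime : p.Prime := Fact.out
  have hv4 : 1 ≤ v ^ 4 := Nat.one_le_pow _ _ hv
  let K := AlgebraicClosure (ZMod p)
  have : CharP K p := charP_of_injective_algebraMap (algebraMap (ZMod p) K).injective p
  obtain ⟨n, hpn⟩ : ∃ n, p = 2 * n + 1 := hprime.odd_of_ne_two (by omega)
  have hK (k : ℕ) (hk : 0 < k) (hk' : k < 400000) : (k : K) ≠ 0 := by
    rw [Ne, CharP.cast_eq_zero_iff K p]
    exact fun h => absurd (Nat.le_of_dvd hk h) (by omega)
  have h3 : (3 : K) ≠ 0 := by exact_mod_cast hK 3 (by norm_num) (by norm_num)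
  have h4 : (4 : K) ≠ 0 := by exact_mod_cast hK 4 (by norm_num) (by norm_num)
  have hc : (a : K) ≠ 0 := by rwa [Ne, CharP.intCast_eq_zero_iff K p]
  set A' := A.map (Int.castRingHom (ZMod p)) with hA'
  set B' := B.map (Int.castRingHom (ZMod p)) with hB'
  have hex : ∀ t ∈ traceResidues A B a p, ∃ l : K, HasLegendreParam p n (a : K)
      (algebraMap (ZMod p) K (A'.eval t)) (algebraMap (ZMod p) K (B'.eval t)) l := by
    intro t ht
    obtain ⟨-, h1, h2⟩ := Finset.mem_filter.1 ht
    have := exists_hasLegendreParam (K := K) p hpn h3 h1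
    rwa [h2] at this
  choose! l hl using hex
  set Λ := (traceResidues A B a p).image l
  have hΛ : Λ.card * v ≤ 33 * p := by
    refine card_mul_le_of_isLegendreTrace p hpn h4 hc ?_ hv hvp
    intro s hs
    obtain ⟨t, ht, rfl⟩ := Finset.mem_image.1 hs
    exact ⟨(hl t ht).1, (hl t ht).2.1, (hl t ht).2.2.1⟩
  have hfib : (traceResidues A B a p).card ≤ (3 * A.natDegree + 2 * B.natDegree) * Λ.card := by
    refine Finset.card_le_mul_card_image _ _ ?_
    intro s hs
    obtain ⟨t₀, ht₀, rfl⟩ := Finset.mem_image.1 hs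
    refine card_filter_proportional_le (P := A' ^ 3) (Q := B' ^ 2) (i := i) (j := j)
      (x := A'.eval t₀ ^ 3) (y := B'.eval t₀ ^ 2) ?_ ?_ ?_ ?_ ?_
    · rw [hA', hB', ← Polynomial.map_pow, ← Polynomial.map_pow]
      simp only [coeff_map, eq_intCast]
      rw [← Int.cast_mul, ← Int.cast_mul, ← Int.cast_sub]
      rwa [Ne, ZMod.intCast_zmod_eq_zero_iff_dvd]
    · refine natDegree_pow_le.trans ?_
      have : A'.natDegree ≤ A.natDegree := natDegree_map_le
      omega
    · refine natDegree_pow_le.trans ?_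
      have : B'.natDegree ≤ B.natDegree := natDegree_map_le
      omega
    · rintro ⟨k1, k2⟩
      obtain ⟨-, h1, -⟩ := Finset.mem_filter.1 ht₀
      apply h1
      rw [k1, k2]
      ring
    · intro t ht
      obtain ⟨ht, htl⟩ := Finset.mem_filter.1 ht
      obtain ⟨-, -, -, u, -, hu1, hu2⟩ := hl t ht
      obtain ⟨-, -, -, w, -, hw1, hw2⟩ := hl t₀ ht₀
      rw [htl] at hu1 hu2
      apply (algebraMap (ZMod p) K).injective
      simp only [eval_pow, map_mul, map_pow]
      rw [hu1, hu2, hw1, hw2]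
      ring
  calc (traceResidues A B a p).card * v
      ≤ (3 * A.natDegree + 2 * B.natDegree) * Λ.card * v := Nat.mul_le_mul_right v hfib
    _ = (3 * A.natDegree + 2 * B.natDegree) * (Λ.card * v) := by ring
    _ ≤ (3 * A.natDegree + 2 * B.natDegree) * (33 * p) := Nat.mul_le_mul_left _ hΛ
    _ = _ := by ring

theorem exists_card_traceResidues_le {A B : ℤ[X]} (hΔ : 4 * A ^ 3 + 27 * B ^ 2 ≠ 0)
    (hj : jNonconstant A B) {a : ℤ} (ha : a ≠ 0) :
    ∃ c : ℝ, 0 < c ∧ ∀ (p : ℕ) [Fact p.Prime],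
      ((traceResidues A B a p).card : ℝ) ≤ c * (p : ℝ) ^ ((3 : ℝ) / 4) := by
  obtain ⟨i, j, hm⟩ := exists_minor_ne_zero hΔ hj
  set m := (A ^ 3).coeff i * (B ^ 2).coeff j - (A ^ 3).coeff j * (B ^ 2).coeff i with hmdef
  set d := 3 * A.natDegree + 2 * B.natDegree with hd
  refine ⟨a.natAbs + m.natAbs + 456976 + 1716 * d, by positivity, ?_⟩
  intro p hp
  have hp0 : 0 < p := hp.out.pos
  have hp1 : (1 : ℝ) ≤ p := by exact_mod_cast hp.out.one_le
  have hpow1 : (1 : ℝ) ≤ (p : ℝ) ^ ((3 : ℝ) / 4) := Real.one_le_rpow hp1 (by norm_num)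
  by_cases hbad : p ≤ a.natAbs + m.natAbs + 456976
  · have h1 : (traceResidues A B a p).card ≤ p := by
      simpa [ZMod.card] using Finset.card_le_univ (traceResidues A B a p)
    have h2 : ((traceResidues A B a p).card : ℝ) ≤ a.natAbs + m.natAbs + 456976 := by
      exact_mod_cast h1.trans hbad
    have h3 : (0 : ℝ) ≤ 1716 * d := by positivity
    calc ((traceResidues A B a p).card : ℝ) ≤ a.natAbs + m.natAbs + 456976 + 1716 * d := by
          linarith
      _ ≤ _ := le_mul_of_one_le_right (by positivity) hpow1
  · have hnd {z : ℤ} (hz : z ≠ 0) (hzp : z.natAbs < p) : ¬ (p : ℤ) ∣ z := by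
      rw [Int.natCast_dvd]
      intro h
      exact absurd (Nat.le_of_dvd (Int.natAbs_pos.2 hz) h) (by omega)
    obtain ⟨q, hq⟩ : ∃ q, q = (p : ℝ) ^ ((1 : ℝ) / 4) := ⟨_, rfl⟩
    have hq0 : 0 < q := by rw [hq]; positivity
    have hq4 : q ^ 4 = p := by
      rw [hq, ← Real.rpow_natCast, ← Real.rpow_mul (by positivity)]
      norm_num
    have hq3 : (p : ℝ) ^ ((3 : ℝ) / 4) = q ^ 3 := by
      rw [hq, ← Real.rpow_natCast, ← Real.rpow_mul (by positivity)]
      norm_num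
    have hp' : (26 : ℝ) ^ 4 ≤ q ^ 4 := by
      rw [hq4]
      have : 456976 ≤ p := by omega
      calc (26 : ℝ) ^ 4 = (456976 : ℕ) := by norm_num
        _ ≤ p := by exact_mod_cast this
    have hq26 : 26 ≤ q := (pow_le_pow_iff_left₀ (by norm_num) hq0.le (by norm_num)).1 hp'
    have hv : 1 ≤ ⌊q / 26⌋₊ := Nat.le_floor (by rw [le_div_iff₀ (by norm_num)]; push_cast; linarith)
    have hfl : (⌊q / 26⌋₊ : ℝ) ≤ q / 26 := Nat.floor_le (by positivity)
    have hfl' : q / 26 < ⌊q / 26⌋₊ + 1 := Nat.lt_floor_add_one _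
    obtain ⟨v, hvdef⟩ : ∃ v, v = ⌊q / 26⌋₊ := ⟨_, rfl⟩
    rw [← hvdef] at hv hfl hfl'
    have hvR : (1 : ℝ) ≤ v := by exact_mod_cast hv
    have hvp : 400000 * v ^ 4 ≤ p := by
      have h1 : (v : ℝ) ^ 4 ≤ (q / 26) ^ 4 := pow_le_pow_left₀ (by positivity) hfl 4
      have h2 : (400000 : ℝ) * v ^ 4 ≤ p := by
        rw [← hq4]
        rw [div_pow] at h1
        have : 0 < q ^ 4 := by positivity
        linarith
      exact_mod_cast h2
    have hmain := card_traceResidues_mul_le (A := A) (B := B) p (hnd ha (by omega))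
      (hnd hm (by omega)) hv hvp
    rw [← hd] at hmain
    have hmain' : ((traceResidues A B a p).card : ℝ) * v ≤ 33 * d * q ^ 4 := by
      rw [hq4]
      exact_mod_cast hmain
    have hvq : q ≤ 52 * v := by linarith
    have hS : ((traceResidues A B a p).card : ℝ) * q ≤ 1716 * d * q ^ 3 * q := by
      calc ((traceResidues A B a p).card : ℝ) * q
          ≤ (traceResidues A B a p).card * (52 * v) := by gcongr
        _ = 52 * ((traceResidues A B a p).card * v) := by ring
        _ ≤ 52 * (33 * d * q ^ 4) := by gcongr
        _ = 1716 * d * q ^ 3 * q := by ring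
    have := le_of_mul_le_mul_right hS hq0
    rw [hq3]
    refine this.trans ?_
    gcongr
    have : (0 : ℝ) ≤ a.natAbs + m.natAbs + 456976 := by positivity
    linarith

theorem card_le_of_pairwise_cross_modEq {p N : ℕ} (hp : 0 < p) {W : Finset (ℕ × ℕ)}
    (hW : ∀ w ∈ W, 1 ≤ w.1 ∧ w.1 ≤ w.2 ∧ w.2 ≤ N ∧ Nat.Coprime w.1 w.2)
    (hmod : ∀ w ∈ W, ∀ w' ∈ W, (w.1 * w'.2 : ℤ) ≡ w'.1 * w.2 [ZMOD p]) :
    W.card ≤ N ^ 2 / p + 1 := by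
  have key : ∀ w ∈ W, ∀ w' ∈ W, w.1 * N ^ 2 / (w.2 * p) = w'.1 * N ^ 2 / (w'.2 * p) →
      ¬ w.1 * w'.2 < w'.1 * w.2 := by
    intro w hw w' hw' h hlt
    obtain ⟨h1, h2, h3, -⟩ := hW w hw
    obtain ⟨h1', h2', h3', -⟩ := hW w' hw'
    have hgap : w.1 * w'.2 + p ≤ w'.1 * w.2 := by
      have hd : (p : ℤ) ∣ w'.1 * w.2 - w.1 * w'.2 := (hmod w hw w' hw').dvd
      have hlt' : (w.1 * w'.2 : ℤ) < w'.1 * w.2 := by exact_mod_cast hlt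
      have := Int.le_of_dvd (by linarith) hd
      zify
      linarith
    set k := w.1 * N ^ 2 / (w.2 * p) with hk
    have k1 : k * (w.2 * p) ≤ w.1 * N ^ 2 := Nat.div_mul_le_self _ _
    have k2 : w'.1 * N ^ 2 < (k + 1) * (w'.2 * p) := by
      rw [h]
      exact (Nat.lt_mul_div_succ _ (Nat.mul_pos (by omega) hp)).trans_eq (mul_comm _ _)
    have k3 : w.2 * w'.2 ≤ N * N := Nat.mul_le_mul h3 h3'
    have l1 := Nat.mul_le_mul_right w'.2 k1
    have l2 := Nat.mul_lt_mul_of_pos_right k2 (show 0 < w.2 by omega)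
    have l3 := Nat.mul_le_mul_right (N ^ 2) hgap
    have l4 := Nat.mul_le_mul_right p k3
    nlinarith
  refine (Finset.card_le_card_of_injOn (t := Finset.range (N ^ 2 / p + 1))
    (fun w => w.1 * N ^ 2 / (w.2 * p)) ?_ ?_).trans (by simp)
  · intro w hw
    obtain ⟨h1, h2, h3, -⟩ := hW w hw
    rw [Finset.coe_range, Set.mem_Iio, Nat.lt_succ_iff]
    calc w.1 * N ^ 2 / (w.2 * p) ≤ w.2 * N ^ 2 / (w.2 * p) := by gcongr
      _ = N ^ 2 / p := Nat.mul_div_mul_left _ _ (by omega)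
  · intro w hw w' hw' h
    have e : w.1 * w'.2 = w'.1 * w.2 :=
      le_antisymm (not_lt.1 (key w' hw' w hw h.symm)) (not_lt.1 (key w hw w' hw' h))
    have c := (hW w hw).2.2.2
    have c' := (hW w' hw').2.2.2
    have e1 : w.1 = w'.1 := Nat.dvd_antisymm
      (c.dvd_of_dvd_mul_right (Dvd.intro _ e)) (c'.dvd_of_dvd_mul_right (Dvd.intro _ e.symm))
    have e2 : w.2 = w'.2 := by
      rw [e1] at e
      exact (Nat.eq_of_mul_eq_mul_left (by have := (hW w' hw').1; omega) e).symm
    exact Prod.ext e1 e2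

theorem mem_fareyPairs {T : ℝ} {w : ℕ × ℕ} : w ∈ fareyPairs T ↔
    (1 ≤ w.1 ∧ w.1 ≤ ⌊T⌋₊) ∧ (1 ≤ w.2 ∧ w.2 ≤ ⌊T⌋₊) ∧ Nat.Coprime w.1 w.2 := by
  simp [fareyPairs, and_assoc]

theorem card_fareyPairs_filter_residue_le (p : ℕ) (hp : 0 < p) (T : ℝ) (t : ZMod p) :
    ((fareyPairs T).filter fun w => (w.1 : ZMod p) = t * w.2).card ≤ 2 * (⌊T⌋₊ ^ 2 / p + 1) := by
  set W := (fareyPairs T).filter fun w => (w.1 : ZMod p) = t * w.2 with hWdef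
  have hW : ∀ w ∈ W, ((1 ≤ w.1 ∧ w.1 ≤ ⌊T⌋₊) ∧ (1 ≤ w.2 ∧ w.2 ≤ ⌊T⌋₊) ∧ Nat.Coprime w.1 w.2) ∧
      (w.1 : ZMod p) = t * w.2 := by
    intro w hw
    rwa [hWdef, Finset.mem_filter, mem_fareyPairs] at hw
  have hmod : ∀ w ∈ W, ∀ w' ∈ W, (w.1 * w'.2 : ℤ) ≡ w'.1 * w.2 [ZMOD p] := by
    intro w hw w' hw'
    rw [← ZMod.intCast_eq_intCast_iff]
    push_cast
    rw [(hW w hw).2, (hW w' hw').2]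
    ring
  have h1 : (W.filter fun w => w.1 ≤ w.2).card ≤ ⌊T⌋₊ ^ 2 / p + 1 := by
    refine card_le_of_pairwise_cross_modEq hp ?_ ?_
    · intro w hw
      obtain ⟨hw, hle⟩ := Finset.mem_filter.1 hw
      obtain ⟨⟨⟨k1, k2⟩, ⟨k3, k4⟩, k5⟩, -⟩ := hW w hw
      exact ⟨k1, hle, k4, k5⟩
    · intro w hw w' hw'
      exact hmod w (Finset.mem_filter.1 hw).1 w' (Finset.mem_filter.1 hw').1
  have h2 : (W.filter fun w => ¬ w.1 ≤ w.2).card ≤ ⌊T⌋₊ ^ 2 / p + 1 := by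
    rw [← Finset.card_image_of_injective _ Prod.swap_injective]
    refine card_le_of_pairwise_cross_modEq hp ?_ ?_
    · intro w' hw'
      obtain ⟨w, hw'', rfl⟩ := Finset.mem_image.1 hw'
      obtain ⟨hw, hle⟩ := Finset.mem_filter.1 hw''
      obtain ⟨⟨⟨k1, k2⟩, ⟨k3, k4⟩, k5⟩, -⟩ := hW w hw
      exact ⟨k3, (not_le.1 hle).le, k2, k5.symm⟩
    · intro z hz z' hz'
      obtain ⟨w, hw, rfl⟩ := Finset.mem_image.1 hz
      obtain ⟨w', hw', rfl⟩ := Finset.mem_image.1 hz'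
      have := hmod w' (Finset.mem_filter.1 hw').1 w (Finset.mem_filter.1 hw).1
      rw [mul_comm (w'.1 : ℤ), mul_comm (w.1 : ℤ)] at this
      exact this
  rw [← Finset.card_filter_add_card_filter_not (s := W) (fun w => w.1 ≤ w.2)]
  omega

theorem card_fareyPairs_filter_dvd_le (p : ℕ) (T : ℝ) :
    ((fareyPairs T).filter fun w => p ∣ w.2).card ≤ ⌊T⌋₊ * (⌊T⌋₊ / p) := by
  have hsub : ((fareyPairs T).filter fun w => p ∣ w.2) ⊆
      Finset.Icc 1 ⌊T⌋₊ ×ˢ ((Finset.Ioc 0 ⌊T⌋₊).filter fun b => p ∣ b) := by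
    intro w hw
    obtain ⟨hw, hd⟩ := Finset.mem_filter.1 hw
    obtain ⟨⟨k1, k2⟩, ⟨k3, k4⟩, -⟩ := mem_fareyPairs.1 hw
    simp only [Finset.mem_product, Finset.mem_Icc, Finset.mem_filter, Finset.mem_Ioc]
    exact ⟨⟨k1, k2⟩, ⟨k3, k4⟩, hd⟩
  refine (Finset.card_le_card hsub).trans ?_
  rw [Finset.card_product, Nat.Ioc_filter_dvd_card_eq_div, Nat.card_Icc, Nat.add_sub_cancel]

section Reduction

variable (p : ℕ) [Fact p.Prime]

theorem ratRed_eq_cast (q : ℚ) : ratRed p q = (q : ZMod p) := by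
  rw [ratRed, Rat.cast_def, div_eq_mul_inv]

theorem den_evalQ_ne_zero_and_cast (A : ℤ[X]) {τ : ℚ} (hτ : (τ.den : ZMod p) ≠ 0) :
    ((evalQ A τ).den : ZMod p) ≠ 0 ∧
      ((evalQ A τ : ℚ) : ZMod p) = (A.map (Int.castRingHom (ZMod p))).eval (τ : ZMod p) := by
  have hdvd {m n : ℕ} (h : m ∣ n) (hn : (n : ZMod p) ≠ 0) : (m : ZMod p) ≠ 0 := by
    obtain ⟨k, rfl⟩ := h
    rw [Nat.cast_mul] at hn
    exact left_ne_zero_of_mul hn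
  induction A using Polynomial.induction_on with
  | C a =>
    rw [evalQ, eval₂_C, map_C, eval_C]
    simp
  | add f g hf hg =>
    have e : evalQ (f + g) τ = evalQ f τ + evalQ g τ := by simp [evalQ]
    rw [e, Rat.cast_add_of_ne_zero hf.1 hg.1, hf.2, hg.2]
    refine ⟨hdvd (Rat.add_den_dvd _ _) ?_, by simp⟩
    rw [Nat.cast_mul]
    exact mul_ne_zero hf.1 hg.1
  | monomial n a h =>
    have e : evalQ (C a * X ^ (n + 1)) τ = evalQ (C a * X ^ n) τ * τ := by
      simp [evalQ, pow_succ, mul_assoc]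
    rw [e, Rat.cast_mul_of_ne_zero h.1 hτ, h.2]
    refine ⟨hdvd (Rat.mul_den_dvd _ _) ?_, by simp [pow_succ, mul_assoc]⟩
    rw [Nat.cast_mul]
    exact mul_ne_zero h.1 hτ

theorem cast_fareyFrac {w : ℕ × ℕ} (hw : ((w.2 : ℕ) : ZMod p) ≠ 0) :
    ((fareyFrac w).den : ZMod p) ≠ 0 ∧ (w.1 : ZMod p) = (fareyFrac w : ZMod p) * w.2 := by
  have hw0 : (w.2 : ℚ) ≠ 0 := by
    intro h
    exact hw (by rw [Nat.cast_eq_zero.1 h, Nat.cast_zero])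
  have hden : ((fareyFrac w).den : ZMod p) ≠ 0 := by
    have h : (fareyFrac w).den ∣ w.2 := by
      have := Rat.den_dvd w.1 w.2
      rw [Rat.divInt_eq_div, Int.cast_natCast, Int.cast_natCast] at this
      exact Int.natCast_dvd_natCast.1 this
    obtain ⟨k, hk⟩ := h
    rw [hk, Nat.cast_mul] at hw
    exact left_ne_zero_of_mul hw
  refine ⟨hden, ?_⟩
  have e : fareyFrac w * (w.2 : ℚ) = (w.1 : ℚ) := div_mul_cancel₀ _ hw0
  have := Rat.cast_mul_of_ne_zero (α := ZMod p) (p := fareyFrac w) (q := (w.2 : ℚ)) hden (by simp)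
  rw [e] at this
  simpa using this

theorem cast_mem_traceResidues {A B : ℤ[X]} {a : ℤ} {w : ℕ × ℕ}
    (hw : ((w.2 : ℕ) : ZMod p) ≠ 0) (hgood : goodRed A B (fareyFrac w) p)
    (ha : apFrob A B (fareyFrac w) p = a) :
    (fareyFrac w : ZMod p) ∈ traceResidues A B a p := by
  have hτ := (cast_fareyFrac p hw).1
  have e : discQ A B (fareyFrac w) = evalQ (-16 * (4 * A ^ 3 + 27 * B ^ 2)) (fareyFrac w) := by
    simp [discQ, evalQ, eval₂_mul, eval₂_add, eval₂_pow]
  refine Finset.mem_filter.2 ⟨Finset.mem_univ _, ?_, ?_⟩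
  · intro h
    apply hgood.2.2
    rw [ratRed_eq_cast, e, (den_evalQ_ne_zero_and_cast p _ hτ).2]
    simp only [Polynomial.map_mul, Polynomial.map_add, Polynomial.map_pow, Polynomial.map_neg,
      Polynomial.map_ofNat, eval_mul, eval_add, eval_pow, eval_ofNat]
    rw [h, mul_zero]
  · rw [apFrob, ratRed_eq_cast, ratRed_eq_cast, (den_evalQ_ne_zero_and_cast p _ hτ).2,
      (den_evalQ_ne_zero_and_cast p _ hτ).2] at ha
    exact ha

open Classical in
theorem card_fareyPairs_trace_le (A B : ℤ[X]) (a : ℤ) (T : ℝ) :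
    ((fareyPairs T).filter fun w =>
      goodRed A B (fareyFrac w) p ∧ apFrob A B (fareyFrac w) p = a).card ≤
    ⌊T⌋₊ * (⌊T⌋₊ / p) + (traceResidues A B a p).card * (2 * (⌊T⌋₊ ^ 2 / p + 1)) := by
  have hsub : ((fareyPairs T).filter fun w =>
      goodRed A B (fareyFrac w) p ∧ apFrob A B (fareyFrac w) p = a) ⊆
      ((fareyPairs T).filter fun w => p ∣ w.2) ∪ (traceResidues A B a p).biUnion fun t =>
        (fareyPairs T).filter fun w => (w.1 : ZMod p) = t * w.2 := by
    intro w hw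
    obtain ⟨hw, hgood, ha⟩ := Finset.mem_filter.1 hw
    rw [Finset.mem_union, Finset.mem_filter, Finset.mem_biUnion]
    by_cases hd : p ∣ w.2
    · exact .inl ⟨hw, hd⟩
    · rw [← CharP.cast_eq_zero_iff (ZMod p) p] at hd
      exact .inr ⟨_, cast_mem_traceResidues p hd hgood ha,
        Finset.mem_filter.2 ⟨hw, (cast_fareyFrac p hd).2⟩⟩
  refine (Finset.card_le_card hsub).trans ((Finset.card_union_le _ _).trans ?_)
  refine Nat.add_le_add (card_fareyPairs_filter_dvd_le p T) ?_
  exact Finset.card_biUnion_le_card_mul _ _ _ fun t _ =>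
    card_fareyPairs_filter_residue_le p (Fact.out : p.Prime).pos T t

end Reduction

open Classical in
theorem sum_PiTrace_eq (A B : ℤ[X]) (a : ℤ) (x T : ℝ) :
    ∑ w ∈ fareyPairs T, PiTrace A B (fareyFrac w) a x =
      ∑ p ∈ (Finset.range (⌊x⌋₊ + 1)).filter Nat.Prime, ((fareyPairs T).filter fun w =>
        goodRed A B (fareyFrac w) p ∧ apFrob A B (fareyFrac w) p = a).card := by
  simp only [PiTrace, Finset.card_filter, Finset.sum_filter]
  rw [Finset.sum_comm]
  refine Finset.sum_congr rfl fun p _ => ?_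
  by_cases hp : p.Prime <;> simp [hp]

theorem sum_rpow_neg_quarter_le (M : ℕ) :
    ∑ k ∈ Finset.range M, ((k : ℝ) + 1) ^ (-(1 : ℝ) / 4) ≤ 2 * (M : ℝ) ^ ((3 : ℝ) / 4) := by
  induction M with
  | zero => simp
  | succ M ih =>
    rw [Finset.sum_range_succ]
    have hM : (0 : ℝ) ≤ M := by positivity
    obtain ⟨r, hr⟩ : ∃ r, r = (M : ℝ) ^ ((1 : ℝ) / 4) := ⟨_, rfl⟩
    obtain ⟨s, hs⟩ : ∃ s, s = ((M : ℝ) + 1) ^ ((1 : ℝ) / 4) := ⟨_, rfl⟩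
    have hr0 : 0 ≤ r := by rw [hr]; positivity
    have hs0 : 0 < s := by rw [hs]; positivity
    have hrs : r ≤ s := by rw [hr, hs]; gcongr; linarith
    have hr4 : r ^ 4 = M := by
      rw [hr, ← Real.rpow_natCast, ← Real.rpow_mul hM]
      norm_num
    have hs4 : s ^ 4 = M + 1 := by
      rw [hs, ← Real.rpow_natCast, ← Real.rpow_mul (by positivity)]
      norm_num
    have hr3 : (M : ℝ) ^ ((3 : ℝ) / 4) = r ^ 3 := by
      rw [hr, ← Real.rpow_natCast, ← Real.rpow_mul hM]
      norm_num
    have hs3 : ((M : ℝ) + 1) ^ ((3 : ℝ) / 4) = s ^ 3 := by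
      rw [hs, ← Real.rpow_natCast, ← Real.rpow_mul (by positivity)]
      norm_num
    have hsi : ((M : ℝ) + 1) ^ (-(1 : ℝ) / 4) = s⁻¹ := by
      rw [hs, ← Real.rpow_neg (by positivity)]
      norm_num
    rw [hr3] at ih
    push_cast
    rw [hsi, hs3]
    have key : s⁻¹ ≤ 2 * (s ^ 3 - r ^ 3) := by
      rw [inv_le_iff_one_le_mul₀ hs0]
      have h1 : (1 : ℝ) = s ^ 4 - r ^ 4 := by rw [hs4, hr4]; ring
      rw [h1]
      have h2 : 0 ≤ (s - r) * (s ^ 3 + s ^ 2 * r + s * r ^ 2 - r ^ 3) := by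
        have h3 : r ^ 3 ≤ s ^ 3 := pow_le_pow_left₀ hr0 hrs 3
        have h4 : 0 ≤ s ^ 2 * r + s * r ^ 2 := by positivity
        exact mul_nonneg (by linarith) (by linarith)
      linarith
    linarith

open Classical in
theorem card_fareyPairs_trace_le_rpow {A B : ℤ[X]} {a : ℤ} {c : ℝ}
    (hS : ∀ (p : ℕ) [Fact p.Prime],
      ((traceResidues A B a p).card : ℝ) ≤ c * (p : ℝ) ^ ((3 : ℝ) / 4))
    {p : ℕ} (hp : p.Prime) {T : ℝ} (hT : 0 < T) :
    (((fareyPairs T).filter fun w =>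
      goodRed A B (fareyFrac w) p ∧ apFrob A B (fareyFrac w) p = a).card : ℝ) ≤
    (1 + 2 * c) * T ^ 2 * (p : ℝ) ^ (-(1 : ℝ) / 4) + 2 * c * (p : ℝ) ^ ((3 : ℝ) / 4) := by
  have : Fact p.Prime := ⟨hp⟩
  have hp0 : (0 : ℝ) < p := by exact_mod_cast hp.pos
  have hp1 : (1 : ℝ) ≤ p := by exact_mod_cast hp.one_le
  have hN : (⌊T⌋₊ : ℝ) ≤ T := Nat.floor_le hT.le
  have h1 : ((⌊T⌋₊ / p : ℕ) : ℝ) ≤ T / p := Nat.cast_div_le.trans (by gcongr)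
  have h2 : ((⌊T⌋₊ ^ 2 / p : ℕ) : ℝ) ≤ T ^ 2 / p := by
    refine Nat.cast_div_le.trans ?_
    push_cast
    gcongr
  have hmain : (((fareyPairs T).filter fun w =>
      goodRed A B (fareyFrac w) p ∧ apFrob A B (fareyFrac w) p = a).card : ℝ) ≤
      (⌊T⌋₊ : ℝ) * ((⌊T⌋₊ / p : ℕ) : ℝ) +
        (traceResidues A B a p).card * (2 * (((⌊T⌋₊ ^ 2 / p : ℕ) : ℝ) + 1)) := by
    exact_mod_cast card_fareyPairs_trace_le p A B a T
  have e1 : (p : ℝ)⁻¹ ≤ (p : ℝ) ^ (-(1 : ℝ) / 4) := by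
    rw [← Real.rpow_neg_one]
    exact Real.rpow_le_rpow_of_exponent_le hp1 (by norm_num)
  have e2 : (p : ℝ) ^ ((3 : ℝ) / 4) * (p : ℝ)⁻¹ = (p : ℝ) ^ (-(1 : ℝ) / 4) := by
    rw [← Real.rpow_neg_one, ← Real.rpow_add hp0]
    norm_num
  calc _ ≤ (⌊T⌋₊ : ℝ) * ((⌊T⌋₊ / p : ℕ) : ℝ) +
        (traceResidues A B a p).card * (2 * (((⌊T⌋₊ ^ 2 / p : ℕ) : ℝ) + 1)) := hmain
    _ ≤ T * (T / p) + c * (p : ℝ) ^ ((3 : ℝ) / 4) * (2 * (T ^ 2 / p + 1)) := by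
      have := hS p
      have h0 : (0 : ℝ) ≤ (traceResidues A B a p).card := by positivity
      gcongr
      exact h0.trans this
    _ = T ^ 2 * (p : ℝ)⁻¹ + 2 * c * T ^ 2 * ((p : ℝ) ^ ((3 : ℝ) / 4) * (p : ℝ)⁻¹) +
        2 * c * (p : ℝ) ^ ((3 : ℝ) / 4) := by
      rw [div_eq_mul_inv, div_eq_mul_inv]
      ring
    _ ≤ T ^ 2 * (p : ℝ) ^ (-(1 : ℝ) / 4) + 2 * c * T ^ 2 * (p : ℝ) ^ (-(1 : ℝ) / 4) +
        2 * c * (p : ℝ) ^ ((3 : ℝ) / 4) := by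
      rw [e2]
      gcongr
    _ = _ := by ring

theorem sum_primes_le_sum_range {f : ℕ → ℝ} (hf : ∀ n, 0 ≤ f n) (M : ℕ) :
    ∑ p ∈ (Finset.range (M + 1)).filter Nat.Prime, f p ≤ ∑ k ∈ Finset.range M, f (k + 1) := by
  have h : ∑ k ∈ Finset.range M, f (k + 1) =
      ∑ k ∈ (Finset.range M).map ⟨(· + 1), add_left_injective 1⟩, f k := by
    rw [Finset.sum_map]
    rfl
  rw [h]
  refine Finset.sum_le_sum_of_subset_of_nonneg ?_ fun n _ _ => hf n
  intro p hp
  obtain ⟨hp, hprime⟩ := Finset.mem_filter.1 hp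
  have := hprime.pos
  rw [Finset.mem_range] at hp
  exact Finset.mem_map.2 ⟨p - 1, by simp only [Finset.mem_range]; omega,
    by simp only [Function.Embedding.coeFn_mk]; omega⟩

theorem sum_PiTrace_le {A B : ℤ[X]} {a : ℤ} {c : ℝ} (hc : 0 < c)
    (hS : ∀ (p : ℕ) [Fact p.Prime],
      ((traceResidues A B a p).card : ℝ) ≤ c * (p : ℝ) ^ ((3 : ℝ) / 4))
    {x T : ℝ} (hx : 0 < x) (hT : 0 < T) :
    ∑ w ∈ fareyPairs T, (PiTrace A B (fareyFrac w) a x : ℝ) ≤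
      2 * (1 + 2 * c) * (T ^ 2 * x ^ ((3 : ℝ) / 4)) + 2 * c * (x * x ^ ((3 : ℝ) / 4)) := by
  classical
  rw [← Nat.cast_sum, sum_PiTrace_eq, Nat.cast_sum]
  have hM : (⌊x⌋₊ : ℝ) ≤ x := Nat.floor_le hx.le
  calc _ ≤ ∑ p ∈ (Finset.range (⌊x⌋₊ + 1)).filter Nat.Prime,
        ((1 + 2 * c) * T ^ 2 * (p : ℝ) ^ (-(1 : ℝ) / 4) + 2 * c * (p : ℝ) ^ ((3 : ℝ) / 4)) :=
        Finset.sum_le_sum fun p hp =>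
          card_fareyPairs_trace_le_rpow hS (Finset.mem_filter.1 hp).2 hT
    _ ≤ ∑ k ∈ Finset.range ⌊x⌋₊, ((1 + 2 * c) * T ^ 2 * ((k + 1 : ℕ) : ℝ) ^ (-(1 : ℝ) / 4) +
          2 * c * ((k + 1 : ℕ) : ℝ) ^ ((3 : ℝ) / 4)) :=
        sum_primes_le_sum_range (f := fun p => (1 + 2 * c) * T ^ 2 * (p : ℝ) ^ (-(1 : ℝ) / 4) +
          2 * c * (p : ℝ) ^ ((3 : ℝ) / 4)) (fun n => by positivity) _
    _ ≤ ∑ k ∈ Finset.range ⌊x⌋₊, ((1 + 2 * c) * T ^ 2 * ((k : ℝ) + 1) ^ (-(1 : ℝ) / 4) +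
          2 * c * x ^ ((3 : ℝ) / 4)) := by
        refine Finset.sum_le_sum fun k hk => ?_
        have hk' : ((k + 1 : ℕ) : ℝ) ≤ x := by
          refine le_trans ?_ hM
          exact_mod_cast Finset.mem_range.1 hk
        rw [← Nat.cast_succ]
        gcongr
    _ = (1 + 2 * c) * T ^ 2 * ∑ k ∈ Finset.range ⌊x⌋₊, ((k : ℝ) + 1) ^ (-(1 : ℝ) / 4) +
          ⌊x⌋₊ * (2 * c * x ^ ((3 : ℝ) / 4)) := by
        rw [Finset.sum_add_distrib, ← Finset.mul_sum, Finset.sum_const, Finset.card_range,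
          nsmul_eq_mul]
    _ ≤ (1 + 2 * c) * T ^ 2 * (2 * x ^ ((3 : ℝ) / 4)) + x * (2 * c * x ^ ((3 : ℝ) / 4)) := by
        have := sum_rpow_neg_quarter_le ⌊x⌋₊
        have h' : (⌊x⌋₊ : ℝ) ^ ((3 : ℝ) / 4) ≤ x ^ ((3 : ℝ) / 4) := by gcongr
        have : ∑ k ∈ Finset.range ⌊x⌋₊, ((k : ℝ) + 1) ^ (-(1 : ℝ) / 4) ≤
          2 * x ^ ((3 : ℝ) / 4) := by linarith
        gcongr
    _ = _ := by ring

theorem PiTrace_le (A B : ℤ[X]) (τ : ℚ) (a : ℤ) (x : ℝ) : PiTrace A B τ a x ≤ ⌊x⌋₊ := by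
  classical
  have hsub : ((Finset.range (⌊x⌋₊ + 1)).filter fun p =>
      p.Prime ∧ goodRed A B τ p ∧ apFrob A B τ p = a) ⊆ Finset.Icc 1 ⌊x⌋₊ := by
    intro p hp
    obtain ⟨hp, hprime, -⟩ := Finset.mem_filter.1 hp
    exact Finset.mem_Icc.2 ⟨hprime.one_le, Nat.lt_succ_iff.1 (Finset.mem_range.1 hp)⟩
  simpa [PiTrace] using Finset.card_le_card hsub

theorem sum_PiTrace_le_trivial (A B : ℤ[X]) (a : ℤ) {x T : ℝ} (hx : 0 < x) (hT : 0 < T) :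
    ∑ w ∈ fareyPairs T, (PiTrace A B (fareyFrac w) a x : ℝ) ≤ T ^ 2 * x := by
  have hcard : (fareyPairs T).card ≤ ⌊T⌋₊ ^ 2 := by
    refine (Finset.card_filter_le _ _).trans ?_
    simp [sq]
  have hcard' : ((fareyPairs T).card : ℝ) ≤ T ^ 2 := by
    calc ((fareyPairs T).card : ℝ) ≤ (⌊T⌋₊ : ℝ) ^ 2 := by exact_mod_cast hcard
      _ ≤ T ^ 2 := by gcongr; exact Nat.floor_le hT.le
  calc _ ≤ ∑ w ∈ fareyPairs T, x := Finset.sum_le_sum fun w _ =>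
        (Nat.cast_le.2 (PiTrace_le A B _ a x)).trans (Nat.floor_le hx.le)
    _ = (fareyPairs T).card * x := by rw [Finset.sum_const, nsmul_eq_mul]
    _ ≤ T ^ 2 * x := by gcongr

end

/-- Average Lang–Trotter bound for Frobenius traces `a ≠ 0`:
`Σ_{τ ∈ F(T), Δ(τ) ≠ 0} Π_{E(τ)}(a, x) ≤ C·(T²·x^{3/4} + T·x^{3/2+ε})`. -/
theorem avg_lang_trotter_trace (A B : Polynomial ℤ)
    (hΔ : 4 * A ^ 3 + 27 * B ^ 2 ≠ 0) (hj : jNonconstant A B)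
    (a : ℤ) (ha : a ≠ 0) (ε : ℝ) (hε : 0 < ε) :
    ∃ C : ℝ, 0 < C ∧ ∀ x T : ℝ, 0 < x → 0 < T →
      ∑ ab ∈ fareyPairs T,
          (if discQ A B (fareyFrac ab) ≠ 0 then
            ((PiTrace A B (fareyFrac ab) a x : ℝ)) else 0) ≤
        C * (T ^ 2 * x ^ ((3 : ℝ) / 4) + T * x ^ ((3 : ℝ) / 2 + ε)) := by
  obtain ⟨c, hc, hS⟩ := exists_card_traceResidues_le hΔ hj ha
  refine ⟨2 * (1 + 2 * c), by positivity, ?_⟩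
  intro x T hx hT
  have hle : ∑ ab ∈ fareyPairs T, (if discQ A B (fareyFrac ab) ≠ 0 then
      ((PiTrace A B (fareyFrac ab) a x : ℝ)) else 0) ≤
      ∑ w ∈ fareyPairs T, (PiTrace A B (fareyFrac w) a x : ℝ) := by
    refine Finset.sum_le_sum fun w _ => ?_
    split_ifs
    · exact le_rfl
    · positivity
  refine hle.trans ?_
  rcases lt_or_ge x 1 with hx1 | hx1
  · have h0 (w : ℕ × ℕ) : PiTrace A B (fareyFrac w) a x = 0 := by
      have := PiTrace_le A B (fareyFrac w) a x
      rwa [Nat.floor_eq_zero.2 hx1, Nat.le_zero] at this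
    simp only [h0, Nat.cast_zero, Finset.sum_const_zero]
    positivity
  have hpow : x ^ ((3 : ℝ) / 2) ≤ x ^ ((3 : ℝ) / 2 + ε) :=
    Real.rpow_le_rpow_of_exponent_le hx1 (by linarith)
  have hhalf : x * x ^ ((1 : ℝ) / 2) = x ^ ((3 : ℝ) / 2) := by
    rw [← Real.rpow_one_add' hx.le (by norm_num)]
    norm_num
  have hquarter : x * x ^ ((3 : ℝ) / 4) = x ^ ((1 : ℝ) / 4) * x ^ ((3 : ℝ) / 2) := by
    rw [← Real.rpow_one_add' hx.le (by norm_num), ← Real.rpow_add hx]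
    norm_num
  rcases lt_or_ge T (x ^ ((1 : ℝ) / 2)) with hTx | hTx
  · calc _ ≤ T ^ 2 * x := sum_PiTrace_le_trivial A B a hx hT
      _ = T * (x * T) := by ring
      _ ≤ T * (x * x ^ ((1 : ℝ) / 2)) := by gcongr
      _ ≤ T * x ^ ((3 : ℝ) / 2 + ε) := by rw [hhalf]; gcongr
      _ ≤ T ^ 2 * x ^ ((3 : ℝ) / 4) + T * x ^ ((3 : ℝ) / 2 + ε) :=
        le_add_of_nonneg_left (by positivity)
      _ ≤ _ := le_mul_of_one_le_left (by positivity) (by linarith)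
  · have hT' : x ^ ((1 : ℝ) / 4) ≤ T :=
      (Real.rpow_le_rpow_of_exponent_le hx1 (by norm_num)).trans hTx
    calc _ ≤ 2 * (1 + 2 * c) * (T ^ 2 * x ^ ((3 : ℝ) / 4)) +
          2 * c * (x * x ^ ((3 : ℝ) / 4)) := sum_PiTrace_le hc hS hx hT
      _ ≤ 2 * (1 + 2 * c) * (T ^ 2 * x ^ ((3 : ℝ) / 4)) +
          2 * (1 + 2 * c) * (T * x ^ ((3 : ℝ) / 2 + ε)) := by
        rw [hquarter]
        gcongr
        linarith
      _ = _ := by ring
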